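/- Let L be a finite simplicial complex of dimension k. If the 2k-dimensional integral van Kampen obstruction vk^{2k}(OL) of the octahedralization OL is nonzero, then the cohomology group H^k(L;Z) has a direct summand isomorphic to Z or to Z/2^r for some r ≥ 1; consequently H_k(L;Z/2) ≠ 0. -/

import Mathlib

open Finset

/-- An abstract simplicial complex on the vertex type `V`: a collection of nonempty
finite subsets of `V` (the simplices, or faces) closed under passing to nonempty subsets. -/
structure SCplx (V : Type) where
  faces : Set (Finset V)
  down_closed : ∀ ⦃s t : Finset V⦄, s ∈ faces → t ⊆ s → t.Nonempty → t ∈ faces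
  nonempty_of_mem : ∀ ⦃s : Finset V⦄, s ∈ faces → s.Nonempty

variable {V : Type}

/-- `L` is a `k`-dimensional complex: every simplex has at most `k+1` vertices and
some simplex has exactly `k+1` vertices. -/
def IsDimOf (L : SCplx V) (k : ℕ) : Prop :=
  (∀ s ∈ L.faces, s.card ≤ k + 1) ∧ ∃ s ∈ L.faces, s.card = k + 1

variable [DecidableEq V] in
/-- A flag complex: every nonempty set of pairwise adjacent vertices spans a simplex. -/
def IsFlag (L : SCplx V) : Prop :=
  ∀ s : Finset V, s.Nonempty →
    (∀ u ∈ s, ∀ w ∈ s, ({u, w} : Finset V) ∈ L.faces) → s ∈ L.faces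

section Oct

variable [DecidableEq V]

/-- The projection `OL → L` on simplices, induced by `V × {±1} → V`
(`Bool` plays the role of `{±1}`, with `false` the minus sign). -/
def pface (s : Finset (V × Bool)) : Finset V := s.image Prod.fst

/-- The octahedralization `OL` of `L`: vertices are doubled, and a set of doubled
vertices spans a simplex iff its first coordinates are distinct and span a simplex of `L`. -/
def oct (L : SCplx V) : SCplx (V × Bool) where
  faces := {s | pface s ∈ L.faces ∧ (pface s).card = s.card}
  down_closed := by
    rintro s t ⟨hf, hc⟩ hts hne
    refine ⟨L.down_closed hf (Finset.image_subset_image hts) ?_, ?_⟩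
    · obtain ⟨x, hx⟩ := hne
      exact ⟨x.1, Finset.mem_image_of_mem _ hx⟩
    · rw [pface, Finset.card_image_iff] at hc ⊢
      exact hc.mono (Finset.coe_subset.mpr hts)
  nonempty_of_mem := by
    rintro s ⟨hf, hc⟩
    by_contra h
    rw [Finset.not_nonempty_iff_eq_empty] at h
    subst h
    simp [pface] at hf
    exact absurd (L.nonempty_of_mem hf) (by simp)

/-- The full subcomplex of `K` on a set `A` of vertices. -/
def fullSub (K : SCplx V) (A : Finset V) : SCplx V where
  faces := {s | s ∈ K.faces ∧ s ⊆ A}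
  down_closed := by
    rintro s t ⟨hs, hA⟩ hts ht
    exact ⟨K.down_closed hs hts ht, hts.trans hA⟩
  nonempty_of_mem := by
    rintro s ⟨hs, -⟩
    exact K.nonempty_of_mem hs

/-- The link of a simplex `σ` in `L`. -/
def scLink (L : SCplx V) (σ : Finset V) : SCplx V where
  faces := {τ | Disjoint σ τ ∧ σ ∪ τ ∈ L.faces ∧ τ.Nonempty}
  down_closed := by
    rintro s t ⟨hd, hf, -⟩ hts ht
    refine ⟨hd.mono_right hts, L.down_closed hf (Finset.union_subset_union (subset_refl σ) hts) ?_, ht⟩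
    obtain ⟨x, hx⟩ := ht
    exact ⟨x, Finset.mem_union_right _ hx⟩
  nonempty_of_mem := by
    rintro s ⟨-, -, h⟩
    exact h

/-- The closed star of a simplex `σ` in `L`; one has `St(σ) = Lk(σ) * σ`. -/
def scStar (L : SCplx V) (σ : Finset V) : SCplx V where
  faces := {τ | τ.Nonempty ∧ σ ∪ τ ∈ L.faces}
  down_closed := by
    rintro s t ⟨-, hf⟩ hts ht
    refine ⟨ht, L.down_closed hf (Finset.union_subset_union (subset_refl σ) hts) ?_⟩
    obtain ⟨x, hx⟩ := ht
    exact ⟨x, Finset.mem_union_right _ hx⟩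
  nonempty_of_mem := by
    rintro s ⟨h, -⟩
    exact h

end Oct

/-- The simplicial join of two complexes. -/
def scJoin {V₁ V₂ : Type} [DecidableEq V₁] [DecidableEq V₂]
    (K₁ : SCplx V₁) (K₂ : SCplx V₂) : SCplx (V₁ ⊕ V₂) where
  faces := {s | s.Nonempty ∧ ∃ (s₁ : Finset V₁) (s₂ : Finset V₂),
    s = s₁.image Sum.inl ∪ s₂.image Sum.inr ∧
    (s₁ = ∅ ∨ s₁ ∈ K₁.faces) ∧ (s₂ = ∅ ∨ s₂ ∈ K₂.faces)}
  down_closed := by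
    rintro s t ⟨hne, s₁, s₂, rfl, h₁, h₂⟩ hts htne
    refine ⟨htne, s₁.filter (fun v => Sum.inl v ∈ t), s₂.filter (fun v => Sum.inr v ∈ t),
      ?_, ?_, ?_⟩
    · ext x
      simp only [Finset.mem_union, Finset.mem_image, Finset.mem_filter]
      constructor
      · intro hx
        have hx' := hts hx
        simp only [Finset.mem_union, Finset.mem_image] at hx'
        rcases hx' with ⟨v, hv, rfl⟩ | ⟨v, hv, rfl⟩
        · exact Or.inl ⟨v, ⟨hv, hx⟩, rfl⟩
        · exact Or.inr ⟨v, ⟨hv, hx⟩, rfl⟩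
      · rintro (⟨v, ⟨hv, hvt⟩, rfl⟩ | ⟨v, ⟨hv, hvt⟩, rfl⟩) <;> assumption
    · by_cases h : s₁.filter (fun v => Sum.inl v ∈ t) = ∅
      · exact Or.inl h
      · right
        rcases h₁ with rfl | h₁
        · simp at h
        · exact K₁.down_closed h₁ (Finset.filter_subset _ _)
            (Finset.nonempty_iff_ne_empty.mpr h)
    · by_cases h : s₂.filter (fun v => Sum.inr v ∈ t) = ∅
      · exact Or.inl h
      · right
        rcases h₂ with rfl | h₂
        · simp at h
        · exact K₂.down_closed h₂ (Finset.filter_subset _ _)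
            (Finset.nonempty_iff_ne_empty.mpr h)
  nonempty_of_mem := by
    rintro s ⟨h, -⟩
    exact h

/-! ### Right-angled Artin groups -/

/-- The standard commutator relators of the right-angled Artin group on the 1-skeleton of `L`. -/
def raagRels [DecidableEq V] (L : SCplx V) : Set (FreeGroup V) :=
  {r | ∃ u w : V, u ≠ w ∧ ({u, w} : Finset V) ∈ L.faces ∧
    r = FreeGroup.of u * FreeGroup.of w * (FreeGroup.of u)⁻¹ * (FreeGroup.of w)⁻¹}

/-- The right-angled Artin group `A_L` associated to a flag complex `L`:
one generator for each vertex, with commuting relations along the edges of `L`. -/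
def RAAG [DecidableEq V] (L : SCplx V) : Type := PresentedGroup (raagRels L)

instance [DecidableEq V] (L : SCplx V) : Group (RAAG L) :=
  inferInstanceAs (Group (PresentedGroup (raagRels L)))

/-! ### Geometric realization -/

/-- The standard basis vertex placement for the geometric realization. -/
def stdVert [DecidableEq V] (v : V) : V → ℝ := fun w => if w = v then 1 else 0

/-- The geometric realization of an abstract simplicial complex, inside `V → ℝ`. -/
def realization [DecidableEq V] (L : SCplx V) : Set (V → ℝ) :=
  ⋃ s ∈ L.faces, convexHull ℝ (stdVert '' (s : Set V))

/-! ### Action dimension and geometric dimension -/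

/-- The action dimension of a group `Γ`: the least dimension of a contractible
(topological) manifold admitting a proper (i.e. properly discontinuous, by
homeomorphisms) `Γ`-action; `⊤` if there is no such manifold. -/
noncomputable def actdim (Γ : Type) [Group Γ] : ℕ∞ :=
  sInf {n : ℕ∞ | ∃ m : ℕ, n = (m : ℕ∞) ∧
    ∃ (M : Type) (_ : TopologicalSpace M) (_ : T2Space M)
      (_ : ChartedSpace (EuclideanSpace ℝ (Fin m)) M) (ρ : Γ →* Equiv.Perm M),
      ContractibleSpace M ∧ (∀ γ : Γ, Continuous (⇑(ρ γ) : M → M)) ∧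
      ∀ K L : Set M, IsCompact K → IsCompact L →
        {γ : Γ | ((⇑(ρ γ) : M → M) '' K ∩ L).Nonempty}.Finite}

/-- The geometric dimension of a group `Γ`: the least dimension of a (simplicial) model
for the classifying space `BΓ`, i.e. the least `m` such that `Γ` acts freely simplicially on
an `m`-dimensional contractible simplicial complex; `⊤` if there is no finite-dimensional
model. -/
noncomputable def gd (Γ : Type) [Group Γ] : ℕ∞ :=
  sInf {n : ℕ∞ | ∃ m : ℕ, n = (m : ℕ∞) ∧
    ∃ (W : Type) (_ : DecidableEq W) (X : SCplx W) (ρ : Γ →* Equiv.Perm W),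
      (∀ (γ : Γ), ∀ s ∈ X.faces, s.image (ρ γ) ∈ X.faces) ∧
      (∀ (γ : Γ), γ ≠ 1 → ∀ s ∈ X.faces, s.image (ρ γ) ≠ s) ∧
      (∀ s ∈ X.faces, s.card ≤ m + 1) ∧
      ContractibleSpace (realization X)}

/-! ### PL embeddings and embedding dimension -/

/-- A compact polyhedron in a real vector space: a finite union of polytopes. -/
def IsCompactPolyhedron {E : Type*} [AddCommGroup E] [Module ℝ E] (S : Set E) : Prop :=
  ∃ F : Finset (Finset E), S = ⋃ t ∈ F, convexHull ℝ (t : Set E)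

/-- A piecewise linear embedding of the compact polyhedron `P` into `Q`: an injective
map `P → Q` whose graph is a compact polyhedron. -/
def HasPLEmbedding {E₁ E₂ : Type*} [AddCommGroup E₁] [Module ℝ E₁]
    [AddCommGroup E₂] [Module ℝ E₂] (P : Set E₁) (Q : Set E₂) : Prop :=
  ∃ f : E₁ → E₂, Set.InjOn f P ∧ f '' P ⊆ Q ∧
    IsCompactPolyhedron {p : E₁ × E₂ | p.1 ∈ P ∧ p.2 = f p.1}

/-- The boundary complex of the `(m+1)`-simplex, a standard PL `m`-sphere. -/
def sphereCplx (m : ℕ) : SCplx (Fin (m + 2)) where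
  faces := {s | s.Nonempty ∧ s ≠ Finset.univ}
  down_closed := by
    rintro s t ⟨-, hs⟩ hts ht
    refine ⟨ht, fun h => hs ?_⟩
    exact Finset.univ_subset_iff.mp (h ▸ hts)
  nonempty_of_mem := fun _ h => h.1

/-- `K` embeds piecewise linearly in the sphere `S^m`. -/
def PLEmbedsInSphere [DecidableEq V] (K : SCplx V) (m : ℕ) : Prop :=
  HasPLEmbedding (realization K) (realization (sphereCplx m))

/-- The embedding dimension of `K`: the least `m` such that `K` piecewise linearly
embeds in `S^m`. -/
noncomputable def embdim [DecidableEq V] (K : SCplx V) : ℕ :=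
  sInf {m | PLEmbedsInSphere K m}

/-! ### Simplicial chains and homology mod 2 -/

/-- A simplicial `k`-chain with `ℤ/2` coefficients on `L`, recorded as its coefficient
function on finite vertex sets: it is supported on the `k`-simplices of `L`. -/
def IsChainOn (L : SCplx V) (k : ℕ) (c : Finset V → ZMod 2) : Prop :=
  ∀ s, c s ≠ 0 → s ∈ L.faces ∧ s.card = k + 1

/-- The mod 2 simplicial boundary operator (the coefficient of `∂c` on `t` is the sum
of the coefficients of `c` over the cofaces of `t`). -/
noncomputable def bd2 [Fintype V] [DecidableEq V] (c : Finset V → ZMod 2) :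
    Finset V → ZMod 2 :=
  fun t => ∑ x ∈ tᶜ, c (insert x t)

/-- `c` is a mod 2 simplicial `k`-cycle on `L`. -/
def IsCycleOn [Fintype V] [DecidableEq V] (L : SCplx V) (k : ℕ)
    (c : Finset V → ZMod 2) : Prop :=
  IsChainOn L k c ∧ ∀ t : Finset V, t.Nonempty → bd2 c t = 0

/-- `H_k(L; ℤ/2) ≠ 0`: there is a mod 2 `k`-cycle which is not a boundary. -/
def ModTwoHomologyNonzero [Fintype V] [DecidableEq V] (L : SCplx V) (k : ℕ) : Prop :=
  ∃ c, IsCycleOn L k c ∧ ¬∃ d, IsChainOn L (k + 1) d ∧ bd2 d = c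

/-! ### The van Kampen obstruction -/

/-- An (ordered) cell `σ × τ` of the simplicial deleted product of `K`. -/
def IsCell {W : Type} (K : SCplx W) (σ τ : Finset W) : Prop :=
  σ ∈ K.faces ∧ τ ∈ K.faces ∧ Disjoint σ τ

/-- An equivariant, augmentation-preserving chain map (mod 2) from the cellular chains of the
simplicial deleted product of `K` to the standard free resolution `W_*` of `ℤ/2` over
`ℤ/2[ℤ/2]` (the cellular chains of `S^∞ = EZ/2`); such a map classifies the free involution.
The value on a cell `(σ,τ)` is the pair of coefficients of `e_n` and `Te_n`, `n = dim σ×τ`. -/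
structure VKMap {W : Type} [DecidableEq W] (K : SCplx W) where
  f : Finset W × Finset W → ZMod 2 × ZMod 2
  supp : ∀ p : Finset W × Finset W, ¬ IsCell K p.1 p.2 → f p = 0
  symm : ∀ σ τ : Finset W, f (τ, σ) = (f (σ, τ)).swap
  aug : ∀ v w : W, IsCell K {v} {w} → (f ({v}, {w})).1 + (f ({v}, {w})).2 = 1
  chain : ∀ σ τ : Finset W, IsCell K σ τ → 3 ≤ σ.card + τ.card →
    ((∑ x ∈ σ, f (σ.erase x, τ)) + (∑ x ∈ τ, f (σ, τ.erase x))) =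
      ((f (σ, τ)).1 + (f (σ, τ)).2, (f (σ, τ)).1 + (f (σ, τ)).2)

/-- The pullback under `Φ` of the standard cocycle representing `w_1^m` on `RP^∞` is a
coboundary in the complex of symmetric (= `ℤ/2`-equivariant) cochains on the deleted
product, i.e. the class `vk^m_{ℤ/2}(K) = c^*(w_1^m) ∈ H^m(C(K); ℤ/2)` vanishes. -/
def vkClassVanishes {W : Type} [DecidableEq W] (K : SCplx W) (Φ : VKMap K) (m : ℕ) : Prop :=
  ∃ η : Finset W × Finset W → ZMod 2,
    (∀ p : Finset W × Finset W, ¬ IsCell K p.1 p.2 → η p = 0) ∧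
    (∀ σ τ : Finset W, η (τ, σ) = η (σ, τ)) ∧
    ∀ σ τ : Finset W, IsCell K σ τ → σ.card + τ.card = m + 2 →
      ((∑ x ∈ σ, η (σ.erase x, τ)) + (∑ x ∈ τ, η (σ, τ.erase x))) =
        (Φ.f (σ, τ)).1 + (Φ.f (σ, τ)).2

/-- Nonvanishing of the mod 2 van Kampen obstruction
`vk^m_{ℤ/2}(K) = c^*(w_1^m) ∈ H^m(C(K); ℤ/2)`. -/
def vkModTwoNonzero {W : Type} [DecidableEq W] (K : SCplx W) (m : ℕ) : Prop :=
  ∃ Φ : VKMap K, ¬ vkClassVanishes K Φ m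

/-- The van Kampen dimension of `K`: the largest `m` with `vk^m_{ℤ/2}(K) ≠ 0`
(with the usual conventions `vkdim ∅ = -2` and `vkdim(point) = -1`). -/
noncomputable def vkdim {W : Type} [DecidableEq W] (K : SCplx W) : ℤ :=
  sSup ({-2} ∪ {m : ℤ | (m = -1 ∧ K.faces.Nonempty) ∨
    ∃ n : ℕ, m = (n : ℤ) ∧ vkModTwoNonzero K n})

/-! ### The integral van Kampen obstruction -/

open Classical in
/-- The sign `(-1)^i` where `i` is the position of `x` in the simplex `σ` ordered by `lt`. -/
noncomputable def osign' {W : Type} (lt : W → W → Prop) (σ : Finset W) (x : W) : ℤ :=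
  (-1) ^ (σ.filter (fun y => lt y x)).card

/-- An equivariant, augmentation-preserving integral chain map from the cellular chains of
the simplicial deleted product of `K` (cells oriented by the order `lt`, the involution acting
with the sign `(-1)^{dim σ · dim τ}`) to the standard free resolution `W_*` of `ℤ` over
`ℤ[ℤ/2]` (with `∂e_n = e_{n-1} + (-1)^n Te_{n-1}`). -/
structure VKMapZ {W : Type} [DecidableEq W] (K : SCplx W) (lt : W → W → Prop) where
  f : Finset W × Finset W → ℤ × ℤ
  supp : ∀ p : Finset W × Finset W, ¬ IsCell K p.1 p.2 → f p = 0
  symm : ∀ σ τ : Finset W,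
    f (τ, σ) = ((-1 : ℤ) ^ ((σ.card - 1) * (τ.card - 1))) • (f (σ, τ)).swap
  aug : ∀ v w : W, IsCell K {v} {w} → (f ({v}, {w})).1 + (f ({v}, {w})).2 = 1
  chain : ∀ σ τ : Finset W, IsCell K σ τ → 3 ≤ σ.card + τ.card →
    ((∑ x ∈ σ, osign' lt σ x • f (σ.erase x, τ)) +
      ((-1 : ℤ) ^ (σ.card - 1)) • ∑ x ∈ τ, osign' lt τ x • f (σ, τ.erase x)) =
      ((f (σ, τ)).1 + (-1 : ℤ) ^ (σ.card + τ.card) * (f (σ, τ)).2,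
       (-1 : ℤ) ^ (σ.card + τ.card) * (f (σ, τ)).1 + (f (σ, τ)).2)

/-- The integral van Kampen class `vk^m(K) = c^*(e_1^m) ∈ H^m(C(K); ℤ)` (in even degree `m`)
vanishes: the pullback under `Φ` of the standard invariant cocycle generating
`H^m(RP^∞;ℤ)` is a coboundary of an invariant integral cochain. -/
def vkZClassVanishes {W : Type} [DecidableEq W] (K : SCplx W) (lt : W → W → Prop)
    (Φ : VKMapZ K lt) (m : ℕ) : Prop :=
  ∃ η : Finset W × Finset W → ℤ,
    (∀ p : Finset W × Finset W, ¬ IsCell K p.1 p.2 → η p = 0) ∧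
    (∀ σ τ : Finset W, η (τ, σ) = ((-1 : ℤ) ^ ((σ.card - 1) * (τ.card - 1))) * η (σ, τ)) ∧
    ∀ σ τ : Finset W, IsCell K σ τ → σ.card + τ.card = m + 2 →
      ((∑ x ∈ σ, osign' lt σ x * η (σ.erase x, τ)) +
        ((-1 : ℤ) ^ (σ.card - 1)) * ∑ x ∈ τ, osign' lt τ x * η (σ, τ.erase x)) =
        (Φ.f (σ, τ)).1 + (Φ.f (σ, τ)).2

/-- Nonvanishing of the integral van Kampen obstruction `vk^m(K) ∈ H^m(C(K); ℤ)`
(`m` even). -/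
def vkZNonzero {W : Type} [DecidableEq W] (K : SCplx W) (lt : W → W → Prop) (m : ℕ) : Prop :=
  ∃ Φ : VKMapZ K lt, ¬ vkZClassVanishes K lt Φ m

/-! ### Orders and meshing -/

/-- The order on the doubled vertices `V × {±1}`: `v⁻ < v⁺ < w⁻ < w⁺ < ⋯` for `v < w`
(`false` is the minus sign). -/
def olt [LT V] (a b : V × Bool) : Prop :=
  a.1 < b.1 ∨ (a.1 = b.1 ∧ a.2 = false ∧ b.2 = true)

/-- The reflexive closure of `olt`. -/
def ole [LT V] (a b : V × Bool) : Prop := olt a b ∨ a = b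

/-- `Meshed r s [v₀,…,v_k] [w₀,…,w_k]` says `r v₀ w₀`, `s w₀ v₁`, `r v₁ w₁`, `s w₁ v₂`, … ,
`r v_k w_k`, i.e. the two vertex lists alternate with respect to the relations `r`, `s`. -/
def Meshed {α : Type*} (r s : α → α → Prop) : List α → List α → Prop
  | [a], [b] => r a b
  | a :: a' :: l₁, b :: l₂ => r a b ∧ s b a' ∧ Meshed r s (a' :: l₁) l₂
  | _, _ => False

/-- `l` is the enumeration of the finite set `σ` in increasing order w.r.t. `r`. -/
def SListOf {α : Type*} [DecidableEq α] (r : α → α → Prop) (l : List α) (σ : Finset α) : Prop :=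
  l.toFinset = σ ∧ l.Chain' r

open Classical in
/-- The standard integral cocycle `ν` representing the top-degree van Kampen obstruction:
on an oriented cell `[σ,τ]` of `C(OL)` (simplices oriented by increasing vertex order)
it is `1` if `σ,τ` mesh, `(-1)^k` if `τ,σ` mesh, `0` otherwise. -/
noncomputable def nuVal [LinearOrder V] (k : ℕ) (σ τ : Finset (V × Bool)) : ℤ :=
  if ∃ l₁ l₂ : List (V × Bool), SListOf olt l₁ σ ∧ SListOf olt l₂ τ ∧ Meshed olt olt l₁ l₂
  then 1
  else if ∃ l₁ l₂ : List (V × Bool), SListOf olt l₁ σ ∧ SListOf olt l₂ τ ∧ Meshed olt olt l₂ l₁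
  then (-1) ^ k
  else 0

open Classical in
/-- The cocycle `μ ∈ Z^{2k}(OL × L; ℤ)`: its value on a cell `(σ, b)` is `1` if
`σ` meshes nonstrictly with the minus-copy `b⁻` of `b` (that is,
`v₀ ≤ w₀⁻ < v₁ ≤ w₁⁻ < ⋯ ≤ w_k⁻`), and `0` otherwise. -/
noncomputable def muVal [LinearOrder V] (σ : Finset (V × Bool)) (b : Finset V) : ℤ :=
  if ∃ (l₁ : List (V × Bool)) (l₂ : List V), SListOf olt l₁ σ ∧
      l₂.toFinset = b ∧ l₂.Chain' (· < ·) ∧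
      Meshed ole olt l₁ (l₂.map (fun w => (w, false)))
  then 1 else 0

/-! ### The chains `Ω`, `s_*`, and `OΔ × M` -/

open Classical in
/-- The vertices of (the support of) a mod 2 cycle `M`. -/
noncomputable def cycVerts [Fintype V] [DecidableEq V] (M : Finset V → ZMod 2) : Finset V :=
  Finset.univ.filter (fun v => ∃ s, M s ≠ 0 ∧ v ∈ s)

/-- The vertex set `M⁻ ∪ {v₀^±, …, v_k^±}` of `D`, the complex `M` doubled over `Δ`. -/
noncomputable def doubledVerts [Fintype V] [DecidableEq V] (M : Finset V → ZMod 2)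
    (Δ : Finset V) : Finset (V × Bool) :=
  (cycVerts M).image (fun v => (v, false)) ∪ Δ.image (fun v => (v, false)) ∪
    Δ.image (fun v => (v, true))

open Classical in
/-- The mod 2 chain `Ω ∈ C_{2k}(C(D); ℤ/2)` (as a symmetric function on ordered pairs):
a `2k`-cell `[σ,τ]` of `C(D)` lies in `Ω` iff `σ ∩ τ = ∅` and `Δ⁰ ⊆ p(σ) ∪ p(τ)`. -/
noncomputable def OmegaChain [DecidableEq V] (D : SCplx (V × Bool)) (Δ : Finset V) (k : ℕ) :
    Finset (V × Bool) × Finset (V × Bool) → ZMod 2 :=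
  fun p => if IsCell D p.1 p.2 ∧ p.1.card + p.2.card = 2 * k + 2 ∧
      Δ ⊆ pface p.1 ∪ pface p.2 then 1 else 0

open Classical in
/-- The pushforward under the chain map
`s : C_*(C(OL)) → C_*(OL × L)`, `[σ,τ] ↦ (σ, p(τ)) + (τ, p(σ))` (mod 2), of a mod 2 chain on
`C(OL)` given as a symmetric function on ordered pairs. -/
noncomputable def pushS [Fintype V] [DecidableEq V]
    (c : Finset (V × Bool) × Finset (V × Bool) → ZMod 2) :
    Finset (V × Bool) × Finset V → ZMod 2 :=
  fun q => ∑ τ : Finset (V × Bool), if pface τ = q.2 then c (q.1, τ) else 0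

open Classical in
/-- The mod 2 chain `OΔ × M ∈ C_{2k}(OL × L; ℤ/2)`. -/
noncomputable def chODeltaM [DecidableEq V] (Δ : Finset V) (M : Finset V → ZMod 2) (k : ℕ) :
    Finset (V × Bool) × Finset V → ZMod 2 :=
  fun q => if pface q.1 = Δ ∧ q.1.card = k + 1 then M q.2 else 0

/-- The mod 2 cellular boundary operator on chains of the configuration space `C(D)`
(symmetric functions on ordered pairs): `∂(σ × τ) = ∂σ × τ + σ × ∂τ`. -/
noncomputable def cBd2 [Fintype V] [DecidableEq V]
    (c : Finset (V × Bool) × Finset (V × Bool) → ZMod 2) :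
    Finset (V × Bool) × Finset (V × Bool) → ZMod 2 :=
  fun p => (∑ x ∈ p.1ᶜ, c (insert x p.1, p.2)) + (∑ x ∈ p.2ᶜ, c (p.1, insert x p.2))

/-- The `*`-condition for `(M, Δ)`: for all simplices `σ, τ` of `M` with
`Δ⁰ ⊆ σ ∪ τ` one has `σ ∩ τ ⊆ Δ`. -/
def StarCond [DecidableEq V] (M : Finset V → ZMod 2) (Δ : Finset V) : Prop :=
  ∀ σ τ : Finset V, M σ ≠ 0 → M τ ≠ 0 → Δ ⊆ σ ∪ τ → σ ∩ τ ⊆ Δ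

/-! ### Rational (reduced) simplicial homology -/

/-- The augmented rational simplicial boundary operator, on coefficient functions
`Finset V → ℚ` (the empty set plays the role of the `(-1)`-simplex, so this computes
reduced homology). -/
noncomputable def bdQ [Fintype V] [DecidableEq V] [LinearOrder V] :
    (Finset V → ℚ) →ₗ[ℚ] (Finset V → ℚ) where
  toFun c := fun t => ∑ x ∈ tᶜ, ((-1 : ℚ) ^ (t.filter (· < x)).card) * c (insert x t)
  map_add' a b := by
    funext t
    simp [mul_add, Finset.sum_add_distrib]
  map_smul' r a := by
    funext t
    simp only [RingHom.id_apply, Pi.smul_apply, smul_eq_mul]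
    rw [Finset.mul_sum]
    exact Finset.sum_congr rfl (fun x _ => by ring)

/-- The submodule of rational `k`-chains on `L`. -/
def chainsQ (L : SCplx V) (k : ℕ) : Submodule ℚ (Finset V → ℚ) where
  carrier := {c | ∀ s, c s ≠ 0 → s ∈ L.faces ∧ s.card = k + 1}
  add_mem' := by
    intro a b ha hb s hs
    by_cases h1 : a s = 0
    · by_cases h2 : b s = 0
      · exact absurd (by simp [h1, h2]) hs
      · exact hb s h2
    · exact ha s h1
  zero_mem' := by intro s hs; simp at hs
  smul_mem' := by
    intro r a ha s hs
    refine ha s (fun h => hs ?_)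
    simp [h]

/-- The reduced rational Betti number `b̄_k(L) = dim_ℚ H̃_k(L; ℚ)`. -/
noncomputable def redBetti [Fintype V] [DecidableEq V] [LinearOrder V]
    (L : SCplx V) (k : ℕ) : ℕ :=
  Module.finrank ℚ
    ((chainsQ L k ⊓ LinearMap.ker bdQ : Submodule ℚ (Finset V → ℚ)) ⧸
      (Submodule.comap (chainsQ L k ⊓ LinearMap.ker bdQ).subtype
        (Submodule.map bdQ (chainsQ L (k + 1)))))

/-! ### Integral simplicial cohomology in the top degree -/

open Classical in
/-- The integral simplicial coboundary operator into degree `k` cochains on `L`. -/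
noncomputable def cobOn [Fintype V] [DecidableEq V] [LinearOrder V] (L : SCplx V) (k : ℕ) :
    (Finset V → ℤ) →ₗ[ℤ] (Finset V → ℤ) where
  toFun φ := fun s => if s ∈ L.faces ∧ s.card = k + 1 then
      ∑ x ∈ s, ((-1 : ℤ) ^ (s.filter (· < x)).card) * φ (s.erase x) else 0
  map_add' a b := by
    funext s
    by_cases h : s ∈ L.faces ∧ s.card = k + 1 <;>
      simp [h, mul_add, Finset.sum_add_distrib]
  map_smul' r a := by
    funext s
    simp only [RingHom.id_apply, Pi.smul_apply, smul_eq_mul]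
    by_cases h : s ∈ L.faces ∧ s.card = k + 1
    · rw [if_pos h, if_pos h, Finset.mul_sum]
      exact Finset.sum_congr rfl (fun x _ => by ring)
    · rw [if_neg h, if_neg h, mul_zero]

/-- The submodule of integral `k`-cochains on `L` (functions supported on `k`-simplices). -/
def cochainsZ (L : SCplx V) (k : ℕ) : Submodule ℤ (Finset V → ℤ) where
  carrier := {c | ∀ s, c s ≠ 0 → s ∈ L.faces ∧ s.card = k + 1}
  add_mem' := by
    intro a b ha hb s hs
    by_cases h1 : a s = 0
    · by_cases h2 : b s = 0
      · exact absurd (by simp [h1, h2]) hs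
      · exact hb s h2
    · exact ha s h1
  zero_mem' := by intro s hs; simp at hs
  smul_mem' := by
    intro r a ha s hs
    refine ha s (fun h => hs ?_)
    simp [h]

open Classical in
/-- The submodule of integral `k`-coboundaries on `L`. -/
noncomputable def cobndZ [Fintype V] [DecidableEq V] [LinearOrder V]
    (L : SCplx V) (k : ℕ) : Submodule ℤ (Finset V → ℤ) :=
  if k = 0 then ⊥ else Submodule.map (cobOn L k) (cochainsZ L (k - 1))

/-- The top-degree integral simplicial cohomology `H^k(L; ℤ)` (for `k = dim L` every
`k`-cochain is a cocycle). -/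
noncomputable def topCohomologyZ [Fintype V] [DecidableEq V] [LinearOrder V]
    (L : SCplx V) (k : ℕ) :=
  (cochainsZ L k) ⧸ (Submodule.comap (cochainsZ L k).subtype (cobndZ L k))

noncomputable instance [Fintype V] [DecidableEq V] [LinearOrder V] (L : SCplx V) (k : ℕ) :
    AddCommGroup (topCohomologyZ L k) :=
  inferInstanceAs (AddCommGroup ((cochainsZ L k) ⧸
    (Submodule.comap (cochainsZ L k).subtype (cobndZ L k))))

/-- A space is aspherical if it admits a contractible covering space. -/
def IsAspherical (X : Type) [TopologicalSpace X] : Prop :=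
  ∃ (Y : Type) (_ : TopologicalSpace Y) (f : Y → X), IsCoveringMap f ∧ ContractibleSpace Y


namespace VKAux

theorem exists_lt_min {W : Type} (lt : W → W → Prop) [IsStrictTotalOrder W lt]
    (s : Finset W) (hs : s.Nonempty) : ∃ x ∈ s, ∀ y ∈ s, y ≠ x → lt x y := by
  classical
  induction s using Finset.induction_on with
  | empty => simp at hs
  | insert a s ha ih =>
    by_cases h : s.Nonempty
    · obtain ⟨x, hx, hm⟩ := ih h
      rcases trichotomous_of lt a x with h1 | h1 | h1
      · refine ⟨a, by simp, fun y hy hya => ?_⟩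
        rcases Finset.mem_insert.1 hy with rfl | hy
        · exact absurd rfl hya
        · by_cases hyx : y = x
          · subst hyx; exact h1
          · exact _root_.trans h1 (hm y hy hyx)
      · subst h1; exact absurd hx ha
      · refine ⟨x, by simp [hx], fun y hy hyx => ?_⟩
        rcases Finset.mem_insert.1 hy with rfl | hy
        · exact h1
        · exact hm y hy hyx
    · rw [Finset.not_nonempty_iff_eq_empty] at h
      subst h
      exact ⟨a, by simp, fun y hy hya => by simp at hy; exact absurd hy hya⟩

theorem min_induction {W : Type} [DecidableEq W] (lt : W → W → Prop) [IsStrictTotalOrder W lt]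
    {P : Finset W → Prop} (h0 : P ∅)
    (h1 : ∀ x s, (∀ y ∈ s, lt x y) → P s → P (insert x s)) (s : Finset W) : P s := by
  induction hn : s.card using Nat.strong_induction_on generalizing s with
  | _ n ih =>
    by_cases hs : s.Nonempty
    · obtain ⟨x, hx, hm⟩ := exists_lt_min lt s hs
      rw [← Finset.insert_erase hx]
      refine h1 x _ (fun y hy => hm y (Finset.mem_of_mem_erase hy) (Finset.ne_of_mem_erase hy)) ?_
      refine ih _ ?_ _ rfl
      rw [← hn]; exact Finset.card_erase_lt_of_mem hx
    · rw [Finset.not_nonempty_iff_eq_empty] at hs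
      subst hs; exact h0

theorem not_mem_of_min {W : Type} {lt : W → W → Prop} [IsStrictTotalOrder W lt]
    {x : W} {s : Finset W} (h : ∀ y ∈ s, lt x y) : x ∉ s :=
  fun hx => irrefl_of lt x (h x hx)

/-- Simplicial coboundary operator. -/
noncomputable def S {W : Type} [DecidableEq W] (lt : W → W → Prop) (σ : Finset W)
    (f : Finset W → ℤ) : ℤ := ∑ x ∈ σ, osign' lt σ x * f (σ.erase x)

theorem S_congr {W : Type} [DecidableEq W] {lt : W → W → Prop} {σ : Finset W}
    {f g : Finset W → ℤ} (h : ∀ x ∈ σ, f (σ.erase x) = g (σ.erase x)) : S lt σ f = S lt σ g :=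
  Finset.sum_congr rfl fun x hx => by rw [h x hx]

theorem S_zero {W : Type} [DecidableEq W] {lt : W → W → Prop} {σ : Finset W}
    {f : Finset W → ℤ} (h : ∀ x ∈ σ, f (σ.erase x) = 0) : S lt σ f = 0 :=
  Finset.sum_eq_zero fun x hx => by rw [h x hx, mul_zero]

theorem S_add {W : Type} [DecidableEq W] {lt : W → W → Prop} {σ : Finset W}
    (f g : Finset W → ℤ) : S lt σ (fun ρ => f ρ + g ρ) = S lt σ f + S lt σ g := by
  simp [S, mul_add, Finset.sum_add_distrib]

theorem S_sub {W : Type} [DecidableEq W] {lt : W → W → Prop} {σ : Finset W}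
    (f g : Finset W → ℤ) : S lt σ (fun ρ => f ρ - g ρ) = S lt σ f - S lt σ g := by
  simp [S, mul_sub, Finset.sum_sub_distrib]

theorem S_mul {W : Type} [DecidableEq W] {lt : W → W → Prop} {σ : Finset W}
    (c : ℤ) (f : Finset W → ℤ) : S lt σ (fun ρ => c * f ρ) = c * S lt σ f := by
  simp only [S, Finset.mul_sum]
  exact Finset.sum_congr rfl fun x _ => by ring

theorem S_comm {W : Type} [DecidableEq W] {lt : W → W → Prop} (σ τ : Finset W)
    (f : Finset W → Finset W → ℤ) :
    S lt σ (fun ρ => S lt τ (fun π => f ρ π)) = S lt τ (fun π => S lt σ (fun ρ => f ρ π)) := by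
  simp only [S, Finset.mul_sum]
  rw [Finset.sum_comm]
  exact Finset.sum_congr rfl fun x _ => Finset.sum_congr rfl fun y _ => by ring

theorem S_insert {W : Type} [DecidableEq W] {lt : W → W → Prop} [IsStrictTotalOrder W lt]
    {x : W} {σ : Finset W} (h : ∀ y ∈ σ, lt x y) (f : Finset W → ℤ) :
    S lt (insert x σ) f = f σ - S lt σ (fun ρ => f (insert x ρ)) := by
  classical
  have hx : x ∉ σ := not_mem_of_min h
  unfold S
  rw [Finset.sum_insert hx, Finset.erase_insert hx]
  have h1 : osign' lt (insert x σ) x = 1 := by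
    unfold osign'
    rw [Finset.filter_eq_empty_iff.2]
    · simp
    · intro y hy
      rcases Finset.mem_insert.1 hy with rfl | hy
      · exact irrefl_of lt _
      · exact asymm_of lt (h y hy)
  rw [h1, one_mul, sub_eq_add_neg, ← Finset.sum_neg_distrib]
  congr 1
  refine Finset.sum_congr rfl fun y hy => ?_
  have hyx : y ≠ x := fun e => hx (e ▸ hy)
  rw [Finset.erase_insert_of_ne hyx.symm]
  have h2 : osign' lt (insert x σ) y = - osign' lt σ y := by
    unfold osign'
    rw [Finset.filter_insert, if_pos (h y hy), Finset.card_insert_of_notMem, pow_succ]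
    · ring
    · simp [hx]
  rw [h2]; ring

theorem S_S {W : Type} [DecidableEq W] {lt : W → W → Prop} [IsStrictTotalOrder W lt]
    (σ : Finset W) (f : Finset W → ℤ) : S lt σ (fun ρ => S lt ρ f) = 0 := by
  induction σ using min_induction lt generalizing f with
  | h0 => simp [S]
  | h1 x s hx ih =>
    have e : S lt s (fun ρ => S lt (insert x ρ) f) =
        S lt s (fun ρ => f ρ - S lt ρ (fun π => f (insert x π))) := S_congr fun y hy =>
      S_insert (fun z hz => hx z (Finset.mem_of_mem_erase hz)) f
    rw [S_insert hx, e, S_sub, ih]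
    ring

/-- Number of elements above `y`. -/
noncomputable def up {W : Type} (lt : W → W → Prop) (σ : Finset W) (y : W) : ℕ :=
  by classical exact (σ.filter (fun z => lt y z)).card

/-- The alternation predicate. -/
def Alt {W : Type} (lt : W → W → Prop) (σ τ : Finset W) : Prop :=
  (∀ y ∈ σ, up lt τ y = up lt σ y + 1) ∧ (∀ y ∈ τ, up lt τ y = up lt σ y)

/-- Sign. -/
def Sg : ℕ → ℤ
  | 0 => -1
  | q + 1 => (-1) ^ (q + 1) * Sg q

open Classical in
/-- The explicit cochain. -/
noncomputable def A {W : Type} (lt : W → W → Prop) (σ τ : Finset W) : ℤ :=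
  if Alt lt σ τ then Sg τ.card else 0

theorem up_insert {W : Type} [DecidableEq W] {lt : W → W → Prop} [IsStrictTotalOrder W lt]
    {x y : W} (σ : Finset W) (h : lt x y) : up lt (insert x σ) y = up lt σ y := by
  classical
  unfold up
  congr 1
  ext z
  simp only [Finset.mem_filter, Finset.mem_insert]
  constructor
  · rintro ⟨rfl | hz, h2⟩
    · exact absurd h (asymm_of lt h2)
    · exact ⟨hz, h2⟩
  · rintro ⟨hz, h2⟩; exact ⟨Or.inr hz, h2⟩

theorem up_min {W : Type} [DecidableEq W] {lt : W → W → Prop} [IsStrictTotalOrder W lt]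
    {x : W} {σ : Finset W} (h : ∀ y ∈ σ, lt x y) : up lt σ x = σ.card := by
  classical
  unfold up
  rw [Finset.filter_true_of_mem h]

theorem up_self {W : Type} [DecidableEq W] {lt : W → W → Prop} [IsStrictTotalOrder W lt]
    {x : W} {σ : Finset W} (h : ∀ y ∈ σ, lt x y) : up lt (insert x σ) x = σ.card := by
  rw [← up_min h]
  classical
  unfold up
  rw [Finset.filter_insert, if_neg (irrefl_of lt x)]

theorem Alt_left {W : Type} [DecidableEq W] {lt : W → W → Prop} [IsStrictTotalOrder W lt]
    {x : W} {σ τ : Finset W} (h : ∀ y ∈ σ, lt x y) (h' : ∀ y ∈ τ, lt x y) :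
    Alt lt (insert x σ) τ ↔ τ.card = σ.card + 1 ∧ Alt lt σ τ := by
  unfold Alt
  rw [Finset.forall_mem_insert, up_self h, up_min h', and_assoc]
  refine and_congr_right fun _ => and_congr ?_ ?_
  · exact forall₂_congr fun y hy => by rw [up_insert _ (h y hy)]
  · exact forall₂_congr fun y hy => by rw [up_insert _ (h' y hy)]

theorem Alt_right {W : Type} [DecidableEq W] {lt : W → W → Prop} [IsStrictTotalOrder W lt]
    {x : W} {σ τ : Finset W} (h : ∀ y ∈ σ, lt x y) (h' : ∀ y ∈ τ, lt x y) :
    Alt lt σ (insert x τ) ↔ τ.card = σ.card ∧ Alt lt σ τ := by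
  unfold Alt
  rw [Finset.forall_mem_insert, up_self h', up_min h, and_left_comm]
  refine and_congr_right fun _ => and_congr ?_ ?_
  · exact forall₂_congr fun y hy => by rw [up_insert _ (h y hy)]
  · exact forall₂_congr fun y hy => by rw [up_insert _ (h' y hy)]

theorem A_left {W : Type} [DecidableEq W] {lt : W → W → Prop} [IsStrictTotalOrder W lt]
    {x : W} {σ τ : Finset W} (h : ∀ y ∈ σ, lt x y) (h' : ∀ y ∈ τ, lt x y) :
    A lt (insert x σ) τ = if τ.card = σ.card + 1 then A lt σ τ else 0 := by
  unfold A
  have e := Alt_left h h'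
  split_ifs with h1 h2 h3 h3 h2 h3 <;> first | rfl | (exfalso; tauto)

theorem A_right {W : Type} [DecidableEq W] {lt : W → W → Prop} [IsStrictTotalOrder W lt]
    {x : W} {σ τ : Finset W} (h : ∀ y ∈ σ, lt x y) (h' : ∀ y ∈ τ, lt x y) :
    A lt σ (insert x τ) = if τ.card = σ.card then (-1) ^ (σ.card + 1) * A lt σ τ else 0 := by
  unfold A
  have e := Alt_right h h'
  rw [Finset.card_insert_of_notMem (not_mem_of_min h')]
  split_ifs with h1 h2 h3 h3 h2 h3 <;> first | rfl | (exfalso; tauto) | (rw [Sg, h2]) | simp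

/-- Splitting off the minimum of a disjoint pair. -/
theorem pair_cases {W : Type} [DecidableEq W] (lt : W → W → Prop) [IsStrictTotalOrder W lt]
    (σ τ : Finset W) (hd : Disjoint σ τ) :
    (σ = ∅ ∧ τ = ∅) ∨
    (∃ x σ', σ = insert x σ' ∧ (∀ y ∈ σ', lt x y) ∧ (∀ y ∈ τ, lt x y) ∧ Disjoint σ' τ) ∨
    (∃ x τ', τ = insert x τ' ∧ (∀ y ∈ σ, lt x y) ∧ (∀ y ∈ τ', lt x y) ∧ Disjoint σ τ') := by
  by_cases hn : (σ ∪ τ).Nonempty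
  · right
    obtain ⟨x, hx, hm⟩ := exists_lt_min lt _ hn
    rcases Finset.mem_union.1 hx with hx | hx
    · left
      have hxt := Finset.disjoint_left.1 hd hx
      refine ⟨x, σ.erase x, (Finset.insert_erase hx).symm, fun y hy => ?_, fun y hy => ?_,
        hd.mono_left (Finset.erase_subset _ _)⟩
      · exact hm y (Finset.mem_union_left _ (Finset.mem_of_mem_erase hy)) (Finset.ne_of_mem_erase hy)
      · exact hm y (Finset.mem_union_right _ hy) (fun e => hxt (e ▸ hy))
    · right
      have hxt := Finset.disjoint_right.1 hd hx
      refine ⟨x, τ.erase x, (Finset.insert_erase hx).symm, fun y hy => ?_, fun y hy => ?_,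
        hd.mono_right (Finset.erase_subset _ _)⟩
      · exact hm y (Finset.mem_union_left _ hy) (fun e => hxt (e ▸ hy))
      · exact hm y (Finset.mem_union_right _ (Finset.mem_of_mem_erase hy)) (Finset.ne_of_mem_erase hy)
  · left
    rw [Finset.not_nonempty_iff_eq_empty, Finset.union_eq_empty] at hn
    exact hn

theorem A_zero {W : Type} [DecidableEq W] {lt : W → W → Prop} [IsStrictTotalOrder W lt]
    {σ τ : Finset W} (hd : Disjoint σ τ) (h1 : τ.card ≠ σ.card) (h2 : τ.card ≠ σ.card + 1) :
    A lt σ τ = 0 := by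
  rcases pair_cases lt σ τ hd with ⟨rfl, rfl⟩ | ⟨x, σ', rfl, ha, hb, -⟩ | ⟨x, τ', rfl, ha, hb, -⟩
  · simp at h1
  · rw [A_left ha hb, if_neg]
    rwa [Finset.card_insert_of_notMem (not_mem_of_min ha)] at h1
  · rw [A_right ha hb, if_neg]
    rw [Finset.card_insert_of_notMem (not_mem_of_min hb)] at h2
    omega

theorem neg_one_sq_pow (n : ℕ) : ((-1 : ℤ) ^ n) * (-1) ^ n = 1 := by
  rw [← mul_pow]; simp

theorem A_main {W : Type} [DecidableEq W] {lt : W → W → Prop} [IsStrictTotalOrder W lt]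
    (n : ℕ) : ∀ (σ τ : Finset W), σ.card + τ.card = n → Disjoint σ τ →
    S lt σ (fun ρ => A lt ρ τ) + (-1) ^ (σ.card + 1) * S lt τ (fun ρ => A lt σ ρ) =
      A lt σ τ + (-1) ^ (σ.card + τ.card) * ((-1) ^ ((σ.card + 1) * (τ.card + 1)) * A lt τ σ) := by
  induction n with
  | zero =>
    intro σ τ hc hd
    have h1 : σ = ∅ := by rw [← Finset.card_eq_zero]; omega
    have h2 : τ = ∅ := by rw [← Finset.card_eq_zero]; omega
    subst h1; subst h2
    simp [S]
  | succ n ih =>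
    intro σ τ hc hd
    have de : ∀ (a b : Finset W) (x : W), Disjoint a b → Disjoint (a.erase x) b :=
      fun a b x h => h.mono_left (Finset.erase_subset _ _)
    have de' : ∀ (a b : Finset W) (x : W), Disjoint a b → Disjoint a (b.erase x) :=
      fun a b x h => h.mono_right (Finset.erase_subset _ _)
    rcases pair_cases lt σ τ hd with ⟨rfl, rfl⟩ | ⟨x, σ', rfl, ha, hb, hd'⟩ |
      ⟨x, τ', rfl, ha, hb, hd'⟩
    · simp at hc
    · have hx := not_mem_of_min ha
      rw [Finset.card_insert_of_notMem hx] at hc ⊢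
      have IH := ih σ' τ (by omega) hd'
      have e1 : S lt σ' (fun ρ => A lt (insert x ρ) τ) =
          if τ.card = σ'.card then S lt σ' (fun ρ => A lt ρ τ) else 0 := by
        rw [S_congr (g := fun ρ => if τ.card = ρ.card + 1 then A lt ρ τ else 0)]
        · split_ifs with h
          · refine S_congr fun y hy => ?_
            have := Finset.card_erase_add_one hy
            rw [if_pos (by omega)]
          · refine S_zero fun y hy => ?_
            have := Finset.card_erase_add_one hy
            rw [if_neg (by omega)]
        · intro y hy
          rw [A_left (fun z hz => ha z (Finset.mem_of_mem_erase hz)) hb]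
      have e2 : S lt τ (fun ρ => A lt (insert x σ') ρ) =
          if τ.card = σ'.card + 2 then S lt τ (fun ρ => A lt σ' ρ) else 0 := by
        rw [S_congr (g := fun ρ => if ρ.card = σ'.card + 1 then A lt σ' ρ else 0)]
        · split_ifs with h
          · refine S_congr fun y hy => ?_
            have := Finset.card_erase_add_one hy
            rw [if_pos (by omega)]
          · refine S_zero fun y hy => ?_
            have := Finset.card_erase_add_one hy
            rw [if_neg (by omega)]
        · intro y hy
          rw [A_left ha (fun z hz => hb z (Finset.mem_of_mem_erase hz))]
      rw [S_insert ha, e1, e2, A_left ha hb, A_right hb ha]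
      by_cases c1 : τ.card = σ'.card + 1
      · rw [if_neg (by omega), if_neg (by omega), if_pos c1, if_neg (by omega)]; ring
      · by_cases c2 : τ.card = σ'.card
        · have z : S lt τ (fun ρ => A lt σ' ρ) = 0 := S_zero fun y hy => by
            have := Finset.card_erase_add_one hy
            exact A_zero (de' _ _ _ hd') (by omega) (by omega)
          rw [z] at IH
          rw [if_pos c2, if_neg (by omega), if_neg (by omega), if_pos c2.symm]
          rw [c2] at IH ⊢
          have p1 : (-1 : ℤ) ^ ((σ'.card + 1) * (σ'.card + 1)) = (-1) ^ (σ'.card + 1) := by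
            rcases Nat.even_or_odd (σ'.card + 1) with h | h
            · rw [h.neg_one_pow, (h.mul_left _).neg_one_pow]
            · rw [h.neg_one_pow, (h.mul h).neg_one_pow]
          have p2 : (-1 : ℤ) ^ ((σ'.card + 1 + 1) * (σ'.card + 1)) = 1 := by
            rw [mul_comm]; exact (Nat.even_mul_succ_self _).neg_one_pow
          have p3 : (-1 : ℤ) ^ (σ'.card + σ'.card) = 1 := (Even.add_self _).neg_one_pow
          have p4 : (-1 : ℤ) ^ (σ'.card + 1 + σ'.card) = -1 :=
            Odd.neg_one_pow ⟨σ'.card, by ring⟩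
          rw [p1, p3] at IH
          rw [p2, p4]
          linear_combination -IH
        · rw [if_neg c2, if_neg c1, if_neg (Ne.symm c2)]
          rw [A_zero hd' c2 c1]
          split_ifs with c3
          · have z : S lt σ' (fun ρ => A lt ρ τ) = 0 := S_zero fun y hy => by
              have := Finset.card_erase_add_one hy
              exact A_zero (de _ _ _ hd') (by omega) (by omega)
            rw [z, A_zero hd' c2 c1, A_zero hd'.symm (by omega) (by omega)] at IH
            rw [pow_succ]
            linear_combination -IH
          · ring
    · have hx := not_mem_of_min hb
      rw [Finset.card_insert_of_notMem hx] at hc ⊢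
      have IH := ih σ τ' (by omega) hd'
      have e1 : S lt τ' (fun ρ => A lt σ (insert x ρ)) =
          if τ'.card = σ.card + 1 then (-1) ^ (σ.card + 1) * S lt τ' (fun ρ => A lt σ ρ)
            else 0 := by
        rw [S_congr (g := fun ρ => if ρ.card = σ.card then
          (-1) ^ (σ.card + 1) * A lt σ ρ else 0), ← S_mul]
        · split_ifs with h
          · refine S_congr fun y hy => ?_
            have := Finset.card_erase_add_one hy
            rw [if_pos (by omega)]
          · refine S_zero fun y hy => ?_
            have := Finset.card_erase_add_one hy
            rw [if_neg (by omega)]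
        · intro y hy
          rw [A_right ha (fun z hz => hb z (Finset.mem_of_mem_erase hz))]
      have e2 : S lt σ (fun ρ => A lt ρ (insert x τ')) =
          if τ'.card + 1 = σ.card then (-1) ^ (σ.card) * S lt σ (fun ρ => A lt ρ τ') else 0 := by
        rw [S_congr (g := fun ρ => if τ'.card = ρ.card then
          (-1) ^ (ρ.card + 1) * A lt ρ τ' else 0), ← S_mul]
        · split_ifs with h
          · refine S_congr fun y hy => ?_
            have := Finset.card_erase_add_one hy
            rw [if_pos (by omega), this]
          · refine S_zero fun y hy => ?_
            have := Finset.card_erase_add_one hy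
            rw [if_neg (by omega)]
        · intro y hy
          rw [A_right (fun z hz => ha z (Finset.mem_of_mem_erase hz)) hb]
      rw [S_insert hb, e1, e2, A_right ha hb, A_left hb ha]
      by_cases c1 : τ'.card = σ.card
      · rw [if_neg (by omega), if_neg (by omega), if_pos c1, if_neg (by omega)]; ring
      · by_cases c2 : τ'.card + 1 = σ.card
        · have z : S lt τ' (fun ρ => A lt σ ρ) = 0 := S_zero fun y hy => by
            have := Finset.card_erase_add_one hy
            exact A_zero (de' _ _ _ hd') (by omega) (by omega)
          rw [z, A_zero hd' (by omega) (by omega)] at IH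
          rw [if_pos c2, if_neg (by omega), if_neg (by omega), if_pos c2.symm]
          rw [A_zero hd' (by omega) (by omega)]
          rw [← c2] at IH ⊢
          have p1 : (-1 : ℤ) ^ ((τ'.card + 1 + 1) * (τ'.card + 1 + 1)) = (-1) ^ (τ'.card) := by
            rcases Nat.even_or_odd (τ'.card) with h | h
            · rw [h.neg_one_pow, Even.neg_one_pow]
              exact Even.mul_left (by simpa [Nat.even_add_one] using h) _
            · rw [h.neg_one_pow, Odd.neg_one_pow]
              have : Odd (τ'.card + 1 + 1) := by simpa [Nat.odd_add_one] using h
              exact this.mul this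
          have p2 : (-1 : ℤ) ^ ((τ'.card + 1 + 1) * (τ'.card + 1)) = 1 := by
            rw [mul_comm]; exact (Nat.even_mul_succ_self _).neg_one_pow
          have p3 : (-1 : ℤ) ^ (τ'.card + 1 + (τ'.card + 1)) = 1 := (Even.add_self _).neg_one_pow
          have p4 : (-1 : ℤ) ^ (τ'.card + 1 + τ'.card) = -1 :=
            Odd.neg_one_pow ⟨τ'.card, by ring⟩
          rw [p2, p4] at IH
          rw [p1, p3, pow_succ]
          linear_combination -(-1) ^ τ'.card * IH
        · rw [if_neg c2, if_neg c1, if_neg (Ne.symm c2)]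
          split_ifs with c3
          · have z : S lt σ (fun ρ => A lt ρ τ') = 0 := S_zero fun y hy => by
              have := Finset.card_erase_add_one hy
              exact A_zero (de _ _ _ hd') (by omega) (by omega)
            rw [z, A_zero hd'.symm (by omega) (by omega)] at IH
            linear_combination -(-1) ^ (σ.card + 1) * IH
          · rw [A_zero hd' c1 c3]; ring

end VKAux

namespace VKAux

/-- The involution on cochains. -/
def T {W : Type} (η : Finset W → Finset W → ℤ) (σ τ : Finset W) : ℤ :=
  (-1) ^ ((σ.card - 1) * (τ.card - 1)) * η τ σ

/-- The coboundary on cochains of the deleted product. -/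
noncomputable def D {W : Type} [DecidableEq W] (lt : W → W → Prop)
    (η : Finset W → Finset W → ℤ) (σ τ : Finset W) : ℤ :=
  S lt σ (fun ρ => η ρ τ) + (-1) ^ (σ.card - 1) * S lt τ (fun ρ => η σ ρ)

/-- Supported on cells. -/
def Supp {W : Type} (K : SCplx W) (η : Finset W → Finset W → ℤ) : Prop :=
  ∀ σ τ, ¬ IsCell K σ τ → η σ τ = 0

section
set_option linter.unusedSectionVars false
variable {W : Type} [DecidableEq W] {lt : W → W → Prop} {K : SCplx W}

theorem cell_symm {σ τ : Finset W} (h : IsCell K σ τ) : IsCell K τ σ :=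
  ⟨h.2.1, h.1, h.2.2.symm⟩

theorem cell_pos {σ τ : Finset W} (h : IsCell K σ τ) : 1 ≤ σ.card ∧ 1 ≤ τ.card :=
  ⟨(K.nonempty_of_mem h.1).card_pos, (K.nonempty_of_mem h.2.1).card_pos⟩

theorem not_cell_left (τ : Finset W) : ¬ IsCell K ∅ τ := fun h => by
  simpa using (cell_pos h).1

theorem not_cell_right (τ : Finset W) : ¬ IsCell K τ ∅ := fun h => by
  simpa using (cell_pos h).2

theorem cell_erase_left {σ τ : Finset W} (h : IsCell K σ τ) (x : W) :
    σ.erase x = ∅ ∨ IsCell K (σ.erase x) τ := by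
  by_cases e : σ.erase x = ∅
  · exact Or.inl e
  · exact Or.inr ⟨K.down_closed h.1 (Finset.erase_subset _ _) (Finset.nonempty_iff_ne_empty.2 e),
      h.2.1, h.2.2.mono_left (Finset.erase_subset _ _)⟩

theorem cell_erase_right {σ τ : Finset W} (h : IsCell K σ τ) (x : W) :
    τ.erase x = ∅ ∨ IsCell K σ (τ.erase x) := by
  rcases cell_erase_left (cell_symm h) x with e | e
  · exact Or.inl e
  · exact Or.inr (cell_symm e)

theorem D_congr {f g : Finset W → Finset W → ℤ} {σ τ : Finset W}
    (h1 : ∀ x ∈ σ, f (σ.erase x) τ = g (σ.erase x) τ)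
    (h2 : ∀ x ∈ τ, f σ (τ.erase x) = g σ (τ.erase x)) : D lt f σ τ = D lt g σ τ := by
  unfold D
  rw [S_congr (f := fun ρ => f ρ τ) (g := fun ρ => g ρ τ) h1,
    S_congr (f := fun ρ => f σ ρ) (g := fun ρ => g σ ρ) h2]

theorem D_add (f g : Finset W → Finset W → ℤ) (σ τ : Finset W) :
    D lt (fun a b => f a b + g a b) σ τ = D lt f σ τ + D lt g σ τ := by
  unfold D
  rw [S_add, S_add]; ring

theorem D_sub (f g : Finset W → Finset W → ℤ) (σ τ : Finset W) :
    D lt (fun a b => f a b - g a b) σ τ = D lt f σ τ - D lt g σ τ := by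
  unfold D
  rw [S_sub, S_sub]; ring

theorem D_mul (c : ℤ) (f : Finset W → Finset W → ℤ) (σ τ : Finset W) :
    D lt (fun a b => c * f a b) σ τ = c * D lt f σ τ := by
  unfold D
  rw [S_mul, S_mul]; ring

theorem Supp_T {η : Finset W → Finset W → ℤ} (h : Supp K η) : Supp K (T η) := fun σ τ hn => by
  unfold T
  rw [h τ σ (fun hc => hn (cell_symm hc)), mul_zero]

theorem T_T (η : Finset W → Finset W → ℤ) (σ τ : Finset W) : T (T η) σ τ = η σ τ := by
  unfold T
  rw [← mul_assoc, mul_comm (τ.card - 1), neg_one_sq_pow, one_mul]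

theorem D_T {η : Finset W → Finset W → ℤ} (h : Supp K η) {σ τ : Finset W}
    (hc : IsCell K σ τ) : D lt (T η) σ τ = T (D lt η) σ τ := by
  obtain ⟨hp, hq⟩ := cell_pos hc
  have key : ∀ r s : ℕ, (-1 : ℤ) ^ (r * s) = (-1) ^ ((r + 1) * s) * (-1) ^ s := by
    intro r s
    rw [add_mul, one_mul, pow_add, mul_assoc, neg_one_sq_pow, mul_one]
  have e1 : S lt σ (fun ρ => T η ρ τ) =
      ((-1) ^ ((σ.card - 1) * (τ.card - 1)) * (-1) ^ (τ.card - 1)) *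
        S lt σ (fun ρ => η τ ρ) := by
    rw [← S_mul]
    refine S_congr fun x hx => ?_
    have hcard := Finset.card_erase_of_mem hx
    unfold T
    rcases cell_erase_left hc x with e | e
    · rw [e, h _ _ (not_cell_right _)]; ring
    · have := (cell_pos e).1
      rw [key, Nat.sub_add_cancel this, hcard]
  have e2 : S lt τ (fun ρ => T η σ ρ) =
      ((-1) ^ ((σ.card - 1) * (τ.card - 1)) * (-1) ^ (σ.card - 1)) *
        S lt τ (fun ρ => η ρ σ) := by
    rw [← S_mul]
    refine S_congr fun x hx => ?_
    have hcard := Finset.card_erase_of_mem hx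
    unfold T
    rcases cell_erase_right hc x with e | e
    · rw [e, h _ _ (not_cell_left _)]; ring
    · have := (cell_pos e).2
      rw [mul_comm (σ.card - 1) (_ - 1), key, Nat.sub_add_cancel this, hcard,
        mul_comm (σ.card - 1) (_ - 1)]
  unfold D
  rw [e1, e2]
  unfold T
  have := neg_one_sq_pow (σ.card - 1)
  linear_combination ((-1) ^ ((σ.card - 1) * (τ.card - 1)) * S lt τ fun ρ => η ρ σ) * this

theorem D_D [IsStrictTotalOrder W lt] {η : Finset W → Finset W → ℤ} (h : Supp K η)
    {σ τ : Finset W} (hc : IsCell K σ τ) : D lt (D lt η) σ τ = 0 := by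
  have e1 : S lt σ (fun ρ => D lt η ρ τ) =
      S lt σ (fun ρ => S lt ρ (fun π => η π τ)) +
        (-(-1) ^ (σ.card - 1)) * S lt σ (fun ρ => S lt τ (fun π => η ρ π)) := by
    rw [← S_mul, ← S_add]
    refine S_congr fun x hx => ?_
    have hcard := Finset.card_erase_of_mem hx
    unfold D
    rcases cell_erase_left hc x with e | e
    · have : S lt τ (fun π => η (σ.erase x) π) = 0 := by
        rw [e]; exact S_zero fun y _ => h _ _ (not_cell_left _)
      rw [this]; ring
    · have := (cell_pos e).1
      obtain ⟨r, hr⟩ : ∃ r, σ.card = r + 2 := ⟨σ.card - 2, by omega⟩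
      rw [hcard, hr]
      simp only [Nat.add_sub_cancel, show r + 2 - 1 = r + 1 by omega, pow_succ]
      ring
  have e2 : S lt τ (fun ρ => D lt η σ ρ) =
      S lt τ (fun π => S lt σ (fun ρ => η ρ π)) +
        (-1) ^ (σ.card - 1) * S lt τ (fun ρ => S lt ρ (fun π => η σ π)) := by
    rw [← S_mul, ← S_add]
    rfl
  have : D lt (D lt η) σ τ = S lt σ (fun ρ => D lt η ρ τ) +
    (-1) ^ (σ.card - 1) * S lt τ (fun ρ => D lt η σ ρ) := rfl
  rw [this, e1, e2, S_S, S_S, S_comm]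
  ring

theorem D_empty_left {η : Finset W → Finset W → ℤ} (h : Supp K η) (τ : Finset W) :
    D lt η ∅ τ = 0 := by
  unfold D
  rw [S_zero (σ := ∅) (by simp), S_zero (fun y _ => h _ _ (not_cell_left _))]; ring

theorem D_empty_right {η : Finset W → Finset W → ℤ} (h : Supp K η) (τ : Finset W) :
    D lt η τ ∅ = 0 := by
  unfold D
  rw [S_zero (σ := ∅) (by simp), S_zero (f := fun ρ => η ρ ∅) (fun y _ => h _ _ (not_cell_right _))]
  ring

/-- The sign of a degree. -/
def eps (σ τ : Finset W) : ℤ := (-1) ^ (σ.card + τ.card)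

/-- If `d` is given by `h` on all faces of a cell, compute `D d`. -/
theorem D_of_htpy [IsStrictTotalOrder W lt] {d h : Finset W → Finset W → ℤ} (hd : Supp K d)
    (hh : Supp K h) (N : ℕ)
    (H : ∀ σ τ, IsCell K σ τ → σ.card + τ.card ≤ N →
      d σ τ = D lt h σ τ + h σ τ - eps σ τ * T h σ τ)
    {σ τ : Finset W} (hc : IsCell K σ τ) (hN : σ.card + τ.card = N + 1) :
    D lt d σ τ = D lt h σ τ + eps σ τ * T (D lt h) σ τ := by
  have e : D lt d σ τ = D lt (fun a b => (D lt h a b + h a b) +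
      eps σ τ * T h a b) σ τ := by
    refine D_congr (fun x hx => ?_) (fun x hx => ?_)
    · have hcard := Finset.card_erase_add_one hx
      rcases cell_erase_left hc x with e | e
      · rw [e, hd _ _ (not_cell_left _), hh _ _ (not_cell_left _), D_empty_left hh,
          Supp_T hh _ _ (not_cell_left _)]; ring
      · rw [H _ _ e (by omega)]
        have : eps σ τ = - eps (σ.erase x) τ := by
          unfold eps
          rw [← hcard]; ring
        rw [this]; ring
    · have hcard := Finset.card_erase_add_one hx
      rcases cell_erase_right hc x with e | e
      · rw [e, hd _ _ (not_cell_right _), hh _ _ (not_cell_right _), D_empty_right hh,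
          Supp_T hh _ _ (not_cell_right _)]; ring
      · rw [H _ _ e (by omega)]
        have : eps σ τ = - eps σ (τ.erase x) := by
          unfold eps
          rw [← hcard]; ring
        rw [this]; ring
  rw [e, D_add, D_add, D_mul, D_D hh hc, D_T hh hc, zero_add]

theorem eps_sq (σ τ : Finset W) : eps σ τ * eps σ τ = 1 := neg_one_sq_pow _

theorem eps_symm (σ τ : Finset W) : eps σ τ = eps τ σ := by
  unfold eps; rw [add_comm]

theorem T_sgn_sq (σ τ : Finset W) :
  ((-1 : ℤ) ^ ((σ.card - 1) * (τ.card - 1))) * (-1) ^ ((τ.card - 1) * (σ.card - 1)) = 1 := by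
  rw [mul_comm (τ.card - 1), neg_one_sq_pow]

theorem htpy [IsStrictTotalOrder W lt] {d : Finset W → Finset W → ℤ} (hd : Supp K d)
    (H : ∀ σ τ, IsCell K σ τ → D lt d σ τ = d σ τ + eps σ τ * T d σ τ) (N : ℕ) :
    ∃ h, Supp K h ∧ ∀ σ τ, IsCell K σ τ → σ.card + τ.card ≤ N →
      d σ τ = D lt h σ τ + h σ τ - eps σ τ * T h σ τ := by
  classical
  induction N with
  | zero =>
    refine ⟨fun _ _ => 0, fun _ _ _ => rfl, fun σ τ hc hN => ?_⟩
    have := cell_pos hc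
    omega
  | succ N ih =>
    obtain ⟨h, hh, Hh⟩ := ih
    let e : Finset W → Finset W → ℤ := fun σ τ =>
      d σ τ - D lt h σ τ - h σ τ + eps σ τ * T h σ τ
    have he : ∀ σ τ, IsCell K σ τ → σ.card + τ.card = N + 1 →
        e σ τ = - (eps σ τ * T e σ τ) := by
      intro σ τ hc hN
      have h1 := H σ τ hc
      rw [D_of_htpy hd hh N Hh hc hN] at h1
      have h2 := eps_sq σ τ
      have h3 := T_T h σ τ
      have h4 : T e σ τ = T d σ τ - T (D lt h) σ τ - T h σ τ + eps σ τ * T (T h) σ τ := by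
        simp only [e, T, eps_symm τ σ]; ring
      rw [h4, h3]
      simp only [e]
      linear_combination -h1 + h σ τ * h2
    let g : Finset W → Finset W → ℤ := fun σ τ =>
      if IsCell K σ τ ∧ σ.card + τ.card = N + 1 ∧ WellOrderingRel σ τ then e σ τ else 0
    have hg : Supp K g := fun σ τ hn => if_neg (fun h => hn h.1)
    refine ⟨fun a b => h a b + g a b, fun σ τ hn => by simp [hh σ τ hn, hg σ τ hn], ?_⟩
    intro σ τ hc hN
    have hDg : D lt g σ τ = 0 := by
      have : D lt g σ τ = D lt (fun _ _ => 0) σ τ := by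
        refine D_congr (fun x hx => if_neg ?_) (fun x hx => if_neg ?_)
        · have hcard := Finset.card_erase_add_one hx
          rintro ⟨-, h, -⟩; omega
        · have hcard := Finset.card_erase_add_one hx
          rintro ⟨-, h, -⟩; omega
      rw [this]; unfold D; rw [S_zero (by simp), S_zero (by simp)]; simp
    rw [D_add, hDg]
    have hT : T (fun a b => h a b + g a b) σ τ = T h σ τ + T g σ τ := by
      unfold T; ring
    rw [hT]
    beta_reduce
    by_cases hN' : σ.card + τ.card ≤ N
    · have g1 : g σ τ = 0 := if_neg (by rintro ⟨-, h, -⟩; omega)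
      have g2 : g τ σ = 0 := if_neg (by rintro ⟨-, h, -⟩; omega)
      have g3 : T g σ τ = 0 := by unfold T; rw [g2, mul_zero]
      rw [Hh σ τ hc hN', g1, g3]; ring
    · have hN2 : σ.card + τ.card = N + 1 := by omega
      have hne : σ ≠ τ := by
        rintro rfl
        have := hc.2.2
        rw [disjoint_self] at this
        have h2 := (cell_pos hc).1
        simp at this; subst this; simp at h2
      have hsum : e σ τ = g σ τ - eps σ τ * T g σ τ := by
        rcases trichotomous_of WellOrderingRel σ τ with hw | hw | hw
        · have g1 : g σ τ = e σ τ := if_pos ⟨hc, hN2, hw⟩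
          have g2 : g τ σ = 0 := if_neg (by rintro ⟨-, -, h⟩; exact asymm_of _ hw h)
          unfold T; rw [g1, g2]; ring
        · exact absurd hw hne
        · have g1 : g σ τ = 0 := if_neg (by rintro ⟨-, -, h⟩; exact asymm_of _ hw h)
          have g2 : g τ σ = e τ σ := if_pos ⟨cell_symm hc, by omega, hw⟩
          have := he σ τ hc hN2
          unfold T at this ⊢; rw [g1, g2, this]; ring
      simp only [e] at hsum
      linear_combination hsum

/-- A cochain encoding an equivariant chain map to the standard resolution. -/
def IsRes (K : SCplx W) (lt : W → W → Prop) (a : Finset W → Finset W → ℤ) : Prop :=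
  Supp K a ∧ ∀ σ τ, IsCell K σ τ →
    D lt a σ τ + (if σ.card + τ.card = 2 then 1 else 0) = a σ τ + eps σ τ * T a σ τ

theorem compare [IsStrictTotalOrder W lt] {a b : Finset W → Finset W → ℤ} (ha : IsRes K lt a)
    (hb : IsRes K lt b) (m : ℕ) (hm : Even m) :
    ∃ h, Supp K h ∧ ∀ σ τ, IsCell K σ τ → σ.card + τ.card = m + 2 →
      (a σ τ + T a σ τ) - (b σ τ + T b σ τ) = D lt h σ τ + D lt (T h) σ τ := by
  have hTd : ∀ σ τ, T (fun x y => a x y - b x y) σ τ = T a σ τ - T b σ τ := by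
    intro σ τ; unfold T; ring
  have hd : Supp K (fun x y => a x y - b x y) := fun σ τ hn => by
    simp [ha.1 σ τ hn, hb.1 σ τ hn]
  have H : ∀ σ τ, IsCell K σ τ → D lt (fun x y => a x y - b x y) σ τ =
      (a σ τ - b σ τ) + eps σ τ * T (fun x y => a x y - b x y) σ τ := by
    intro σ τ hc
    rw [D_sub, hTd]
    linear_combination ha.2 σ τ hc - hb.2 σ τ hc
  obtain ⟨h, hh, Hh⟩ := htpy hd H (m + 1)
  refine ⟨h, hh, fun σ τ hc hN => ?_⟩
  have h1 := D_of_htpy hd hh (m + 1) Hh hc (by omega)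
  have h2 := H σ τ hc
  have h3 : eps σ τ = 1 := by
    unfold eps; rw [hN]
    exact Even.neg_one_pow (by simpa [Nat.even_add] using hm)
  rw [h3, hTd] at h2
  rw [h3] at h1
  rw [D_T hh hc]
  linear_combination h1 - h2

theorem IsRes_of_map (Φ : VKMapZ K lt) : IsRes K lt (fun σ τ => (Φ.f (σ, τ)).1) ∧
    ∀ σ τ, (Φ.f (σ, τ)).2 = T (fun σ τ => (Φ.f (σ, τ)).1) σ τ := by
  have hT : ∀ σ τ, (Φ.f (σ, τ)).2 = T (fun σ τ => (Φ.f (σ, τ)).1) σ τ := by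
    intro σ τ
    have := congrArg Prod.snd (Φ.symm τ σ)
    simp only [Prod.smul_snd, Prod.snd_swap, smul_eq_mul] at this
    rw [this, mul_comm (τ.card - 1)]
    rfl
  have hs : Supp K (fun σ τ => (Φ.f (σ, τ)).1) := fun σ τ hn => by
    simp [Φ.supp (σ, τ) hn]
  refine ⟨⟨hs, fun σ τ hc => ?_⟩, hT⟩
  rw [← hT]
  have hp := cell_pos hc
  split_ifs with h2
  · have h1 : σ.card = 1 := by omega
    have h2' : τ.card = 1 := by omega
    have e : eps σ τ = 1 := by unfold eps; rw [h2]; norm_num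
    obtain ⟨v, rfl⟩ := Finset.card_eq_one.1 h1
    obtain ⟨w, rfl⟩ := Finset.card_eq_one.1 h2'
    rw [e, one_mul, Φ.aug v w hc]
    unfold D
    rw [S_zero, S_zero]
    · ring
    · intro x hx
      simp only [Finset.mem_singleton] at hx
      subst hx
      have e : ({x} : Finset W).erase x = ∅ := by simp
      rw [e]; exact hs _ _ (not_cell_right _)
    · intro x hx
      simp only [Finset.mem_singleton] at hx
      subst hx
      have e : ({x} : Finset W).erase x = ∅ := by simp
      rw [e]; exact hs _ _ (not_cell_left _)
  · have h3 := congrArg Prod.fst (Φ.chain σ τ hc (by omega))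
    simp only [Prod.fst_add, Prod.smul_fst, Prod.fst_sum, smul_eq_mul] at h3
    rw [add_zero]
    exact h3

open Classical in
/-- The explicit cochain on cells. -/
noncomputable def A0 (K : SCplx W) (lt : W → W → Prop) (σ τ : Finset W) : ℤ :=
  if IsCell K σ τ then A lt σ τ else 0

theorem A0_cell {σ τ : Finset W} (hc : IsCell K σ τ) : A0 K lt σ τ = A lt σ τ := if_pos hc

theorem A_empty_single [IsStrictTotalOrder W lt] (w : W) : A lt ∅ {w} = 1 := by
  have := A_right (lt := lt) (x := w) (σ := ∅) (τ := ∅) (by simp) (by simp)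
  have h0 : A lt (∅ : Finset W) ∅ = -1 := by
    unfold A
    rw [if_pos]
    · simp [Sg]
    · simp [Alt]
  rw [h0] at this
  simpa using this

theorem IsRes_A0 [IsStrictTotalOrder W lt] : IsRes K lt (A0 K lt) := by
  refine ⟨fun σ τ hn => if_neg hn, fun σ τ hc => ?_⟩
  obtain ⟨hp, hq⟩ := cell_pos hc
  have hm := A_main (lt := lt) _ σ τ rfl hc.2.2
  have hT : T (A0 K lt) σ τ = (-1) ^ ((σ.card + 1) * (τ.card + 1)) * A lt τ σ := by
    unfold T
    rw [A0_cell (cell_symm hc)]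
    congr 1
    obtain ⟨p, hp'⟩ : ∃ p, σ.card = p + 1 := ⟨σ.card - 1, by omega⟩
    obtain ⟨q, hq'⟩ : ∃ q, τ.card = q + 1 := ⟨τ.card - 1, by omega⟩
    rw [hp', hq']
    have : (p + 1 + 1) * (q + 1 + 1) = p * q + 2 * (p + q + 2) := by ring
    rw [this, pow_add, pow_mul _ 2, neg_one_sq, one_pow, mul_one]
    rfl
  rw [A0_cell hc, hT]
  unfold eps
  rw [← hm]
  have hs : (-1 : ℤ) ^ (σ.card - 1) = (-1) ^ (σ.card + 1) := by
    obtain ⟨p, hp'⟩ : ∃ p, σ.card = p + 1 := ⟨σ.card - 1, by omega⟩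
    rw [hp']; simp [pow_succ]
  unfold D
  have e2 : S lt τ (fun ρ => A0 K lt σ ρ) = S lt τ (fun ρ => A lt σ ρ) := by
    refine S_congr fun x hx => ?_
    rcases cell_erase_right hc x with e | e
    · rw [e, A_zero (by simp) (by simp; omega) (by simp)]
      exact if_neg (not_cell_right _)
    · exact A0_cell e
  rw [e2, hs]
  have e1 : S lt σ (fun ρ => A0 K lt ρ τ) + (if σ.card + τ.card = 2 then 1 else 0) =
      S lt σ (fun ρ => A lt ρ τ) := by
    split_ifs with h2
    · have h1 : σ.card = 1 := by omega
      have h2' : τ.card = 1 := by omega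
      obtain ⟨v, rfl⟩ := Finset.card_eq_one.1 h1
      obtain ⟨w, rfl⟩ := Finset.card_eq_one.1 h2'
      have q : ∀ f : Finset W → ℤ, S lt {v} f = f ∅ := by
        intro f
        have := S_insert (lt := lt) (x := v) (σ := ∅) (by simp) f
        simpa [S] using this
      rw [q, q, A_empty_single]
      have : A0 K lt ∅ {w} = 0 := if_neg (not_cell_left _)
      rw [this]; rfl
    · rw [add_zero]
      refine S_congr fun x hx => ?_
      have hcard := Finset.card_erase_add_one hx
      rcases cell_erase_left hc x with e | e
      · have : (σ.erase x).card = 0 := by rw [e]; rfl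
        rw [e, A_zero (by simp) (by rw [Finset.card_empty]; omega) (by rw [Finset.card_empty]; omega)]
        exact if_neg (not_cell_left _)
      · exact A0_cell e
  linear_combination e1

theorem vanish [IsStrictTotalOrder W lt] (Φ : VKMapZ K lt) (k : ℕ) (hk : 1 ≤ k)
    (G : Finset W → Finset W → ℤ) (hG : Supp K G) (j : ℤ)
    (H : ∀ σ τ, IsCell K σ τ → σ.card + τ.card = 2 * k + 2 →
      D lt G σ τ = (2 * j + 1) * A0 K lt σ τ) :
    vkZClassVanishes K lt Φ (2 * k) := by
  obtain ⟨hres, hΦT⟩ := IsRes_of_map Φ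
  obtain ⟨h, hh, Hh⟩ := compare hres (IsRes_A0 (K := K) (lt := lt)) (2 * k) (by simp)
  have hA := (IsRes_A0 (K := K) (lt := lt))
  let u : Finset W → Finset W → ℤ := fun a b => h a b + G a b - j * A0 K lt a b
  have hu : Supp K u := fun σ τ hn => by
    simp [u, hh σ τ hn, hG σ τ hn, hA.1 σ τ hn]
  let η : Finset W → Finset W → ℤ := fun a b => u a b + T u a b
  have hη : Supp K η := fun σ τ hn => by simp [η, hu σ τ hn, Supp_T hu σ τ hn]
  refine ⟨fun p => η p.1 p.2, fun p hn => hη _ _ hn, fun σ τ => ?_, fun σ τ hc hN => ?_⟩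
  · simp only [η, T]
    linear_combination (-u τ σ) * neg_one_sq_pow ((σ.card - 1) * (τ.card - 1)) +
      (u σ τ) * congrArg (fun n => (-1 : ℤ) ^ n) (mul_comm (τ.card - 1) (σ.card - 1))
  · change D lt η σ τ = _
    rw [hΦT]
    have hDu : ∀ σ τ, D lt u σ τ = D lt h σ τ + D lt G σ τ - j * D lt (A0 K lt) σ τ := by
      intro σ τ
      simp only [u]
      rw [D_sub, D_mul, D_add]
    have h1 := Hh σ τ hc hN
    have h2 := H σ τ hc hN
    have h3 := H τ σ (cell_symm hc) (by omega)
    have h4 := hA.2 σ τ hc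
    have h5 := hA.2 τ σ (cell_symm hc)
    rw [if_neg (by omega), add_zero] at h4 h5
    have e1 : eps σ τ = 1 := by
      unfold eps; rw [hN]; exact Even.neg_one_pow ⟨k + 1, by ring⟩
    have e2 : eps τ σ = 1 := by rw [eps_symm, e1]
    rw [e1, one_mul] at h4
    rw [e2, one_mul] at h5
    have h6 : T (A0 K lt) τ σ = (-1) ^ ((σ.card - 1) * (τ.card - 1)) * A0 K lt σ τ := by
      unfold T; rw [mul_comm (τ.card - 1)]
    have h7 : A0 K lt τ σ = (-1) ^ ((σ.card - 1) * (τ.card - 1)) * T (A0 K lt) σ τ := by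
      unfold T; rw [← mul_assoc, neg_one_sq_pow, one_mul]
    have h8 := neg_one_sq_pow ((σ.card - 1) * (τ.card - 1))
    have e3 : D lt η σ τ = D lt u σ τ + T (D lt u) σ τ := by
      simp only [η]; rw [D_add, D_T hu hc]
    have e4 : T (D lt u) σ τ = T (D lt h) σ τ +
        (-1) ^ ((σ.card - 1) * (τ.card - 1)) * D lt G τ σ -
        j * ((-1) ^ ((σ.card - 1) * (τ.card - 1)) * D lt (A0 K lt) τ σ) := by
      unfold T; rw [hDu]; ring
    rw [e3, e4, hDu, h2, h3, h4, h5, h6, h7]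
    rw [D_T hh hc] at h1
    generalize (-1 : ℤ) ^ ((σ.card - 1) * (τ.card - 1)) = s at *
    linear_combination -h1 + ((j + 1) * T (A0 K lt) σ τ - j * A0 K lt σ τ) * h8

end
end VKAux

namespace VKAux

instance olt_sto {V : Type} [LinearOrder V] : IsStrictTotalOrder (V × Bool) olt where
  irrefl a := by
    rintro (h | ⟨-, h1, h2⟩)
    · exact lt_irrefl _ h
    · rw [h1] at h2; exact Bool.noConfusion h2
  trans a b c := by
    rintro (h | ⟨h, h1, h2⟩) (h' | ⟨h', h1', h2'⟩)
    · exact Or.inl (h.trans h')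
    · exact Or.inl (h' ▸ h)
    · exact Or.inl (h ▸ h')
    · rw [h2] at h1'; exact Bool.noConfusion h1'
  trichotomous a b := by
    intro h1 h2
    rcases lt_trichotomy a.1 b.1 with h | h | h
    · exact absurd (Or.inl h) h1
    · refine Prod.ext h ?_
      rcases ha : a.2 with _ | _ <;> rcases hb : b.2 with _ | _
      · rfl
      · exact absurd (Or.inr ⟨h, ha, hb⟩) h1
      · exact absurd (Or.inr ⟨h.symm, hb, ha⟩) h2
      · rfl
    · exact absurd (Or.inl h) h2

section
variable {V : Type} [DecidableEq V] [LinearOrder V]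

theorem inj_of_card {τ : Finset (V × Bool)} (h : (pface τ).card = τ.card) :
    ∀ x ∈ τ, ∀ y ∈ τ, x.1 = y.1 → x = y := by
  intro x hx y hy e
  rw [pface, Finset.card_image_iff] at h
  exact h hx hy e

open Classical in
theorem card_filter_pface {τ : Finset (V × Bool)} (h : (pface τ).card = τ.card)
    (P : V → Prop) (Q : V × Bool → Prop) (hPQ : ∀ z ∈ τ, Q z ↔ P z.1) :
    (τ.filter Q).card = ((pface τ).filter P).card := by
  have e : (pface τ).filter P = (τ.filter Q).image Prod.fst := by
    ext u
    simp only [pface, Finset.mem_filter, Finset.mem_image]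
    constructor
    · rintro ⟨⟨z, hz, rfl⟩, hP⟩
      exact ⟨z, ⟨hz, (hPQ z hz).2 hP⟩, rfl⟩
    · rintro ⟨z, ⟨hz, hQ⟩, rfl⟩
      exact ⟨⟨z, hz, rfl⟩, (hPQ z hz).1 hQ⟩
  rw [e, Finset.card_image_of_injOn]
  intro x hx y hy e
  exact inj_of_card h x (Finset.mem_of_mem_filter x hx) y (Finset.mem_of_mem_filter y hy) e

theorem olt_iff_of_inj {τ : Finset (V × Bool)} (h : (pface τ).card = τ.card)
    {y z : V × Bool} (hy : y ∈ τ) (hz : z ∈ τ) : olt y z ↔ y.1 < z.1 := by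
  constructor
  · rintro (h1 | ⟨h1, h2, h3⟩)
    · exact h1
    · have := inj_of_card h y hy z hz h1
      subst this
      rw [h2] at h3; exact Bool.noConfusion h3
  · exact Or.inl

theorem S_pface {τ : Finset (V × Bool)} (h : (pface τ).card = τ.card) (g : Finset V → ℤ) :
    S olt τ (fun ρ => g (pface ρ)) =
      ∑ u ∈ pface τ, ((-1 : ℤ) ^ ((pface τ).filter (· < u)).card) * g ((pface τ).erase u) := by
  classical
  unfold S
  have : ∀ F : V → ℤ, ∑ u ∈ pface τ, F u = ∑ x ∈ τ, F x.1 := by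
    intro F
    rw [pface, Finset.sum_image]
    intro x hx y hy e
    exact inj_of_card h x hx y hy e
  rw [this]
  refine Finset.sum_congr rfl fun x hx => ?_
  congr 1
  · unfold osign'
    congr 1
    convert card_filter_pface h (fun u => u < x.1) (fun z => olt z x)
      (fun z hz => olt_iff_of_inj h hz hx)
  · beta_reduce
    congr 1
    ext u
    simp only [pface, Finset.mem_erase, Finset.mem_image]
    constructor
    · rintro ⟨z, ⟨hzx, hz⟩, rfl⟩
      exact ⟨fun e => hzx (inj_of_card h z hz x hx e), z, hz, rfl⟩
    · rintro ⟨hu, z, hz, rfl⟩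
      exact ⟨z, ⟨fun e => hu (by rw [e]), hz⟩, rfl⟩

open Classical in
/-- Alternation of `σ` with a simplex of `L`. -/
def AltL (σ : Finset (V × Bool)) (b : Finset V) : Prop :=
  (∀ y ∈ σ, (b.filter (fun u => y.1 < u ∨ (u = y.1 ∧ y.2 = false))).card = up olt σ y + 1) ∧
  (∀ u ∈ b, (b.filter (fun w => u < w)).card =
    (σ.filter (fun z => u < z.1 ∨ (z.1 = u ∧ z.2 = true))).card)

theorem Alt_iff_AltL {σ τ : Finset (V × Bool)} (hd : Disjoint σ τ)
    (h : (pface τ).card = τ.card) : Alt olt σ τ ↔ AltL σ (pface τ) := by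
  classical
  unfold Alt AltL
  refine and_congr ?_ ?_
  · refine forall₂_congr fun y hy => ?_
    have : up olt τ y =
        ((pface τ).filter (fun u => y.1 < u ∨ (u = y.1 ∧ y.2 = false))).card := by
      unfold up
      convert card_filter_pface h _ _ ?_
      intro z hz
      have hne : y ≠ z := fun e => Finset.disjoint_left.1 hd hy (e ▸ hz)
      unfold olt
      constructor
      · rintro (h1 | ⟨h1, h2, h3⟩)
        · exact Or.inl h1
        · exact Or.inr ⟨h1.symm, h2⟩
      · rintro (h1 | ⟨h1, h2⟩)
        · exact Or.inl h1
        · refine Or.inr ⟨h1.symm, h2, ?_⟩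
          by_contra h3
          rw [Bool.not_eq_true] at h3
          exact hne (Prod.ext h1.symm (h2.trans h3.symm))
    rw [this]
  · have q : (∀ u ∈ pface τ, ((pface τ).filter (fun w => u < w)).card =
        (σ.filter (fun z => u < z.1 ∨ (z.1 = u ∧ z.2 = true))).card) ↔
        ∀ y ∈ τ, ((pface τ).filter (fun w => y.1 < w)).card =
        (σ.filter (fun z => y.1 < z.1 ∨ (z.1 = y.1 ∧ z.2 = true))).card := by
      simp only [pface, Finset.forall_mem_image]
    have q2 : (∀ y ∈ τ, up olt τ y = up olt σ y) ↔
        ∀ y ∈ τ, ((pface τ).filter (fun w => y.1 < w)).card =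
        (σ.filter (fun z => y.1 < z.1 ∨ (z.1 = y.1 ∧ z.2 = true))).card := by
      refine forall₂_congr fun y hy => ?_
      have e1 : up olt τ y = ((pface τ).filter (fun w => y.1 < w)).card := by
        unfold up
        convert card_filter_pface h _ _ ?_
        intro z hz
        exact olt_iff_of_inj h hy hz
      have e2 : up olt σ y =
          (σ.filter (fun z => y.1 < z.1 ∨ (z.1 = y.1 ∧ z.2 = true))).card := by
        unfold up
        congr 1
        refine Finset.filter_congr fun z hz => ?_
        have hne : z ≠ y := fun e => Finset.disjoint_left.1 hd hz (e ▸ hy)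
        unfold olt
        constructor
        · rintro (h1 | ⟨h1, h2, h3⟩)
          · exact Or.inl h1
          · exact Or.inr ⟨h1.symm, h3⟩
        · rintro (h1 | ⟨h1, h2⟩)
          · exact Or.inl h1
          · refine Or.inr ⟨h1.symm, ?_, h2⟩
            by_contra h3
            rw [Bool.not_eq_false] at h3
            exact hne (Prod.ext h1 (h2.trans h3.symm))
      rw [e1, e2]
    rw [q2, ← q]

open Classical in
/-- The cochain `μ`, up to sign. -/
noncomputable def M (σ : Finset (V × Bool)) (b : Finset V) : ℤ :=
  if AltL σ b then Sg b.card else 0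

theorem A_eq_M {σ τ : Finset (V × Bool)} (hd : Disjoint σ τ)
    (h : (pface τ).card = τ.card) : A olt σ τ = M σ (pface τ) := by
  have := Alt_iff_AltL hd h
  unfold A M
  rw [h]
  split_ifs <;> first | rfl | (exfalso; tauto)

theorem vanish_oct [Fintype V] (L : SCplx V) (k : ℕ) (hk : 1 ≤ k) (hdim : IsDimOf L k)
    (j : ℤ) (H : ∀ c ∈ cochainsZ L k, (2 * j + 1) • c ∈ cobndZ L k) (Φ : VKMapZ (oct L) olt) :
    vkZClassVanishes (oct L) olt Φ (2 * k) := by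
  classical
  have Hg : ∀ σ : Finset (V × Bool), ∃ g : Finset V → ℤ, ∀ b ∈ L.faces, b.card = k + 1 →
      ∑ x ∈ b, ((-1 : ℤ) ^ (b.filter (· < x)).card) * g (b.erase x) = (2 * j + 1) * M σ b := by
    intro σ
    have h1 := H (fun s => if s ∈ L.faces ∧ s.card = k + 1 then M σ s else 0) (by
      intro s hs
      by_contra hn
      exact hs (if_neg hn))
    unfold cobndZ at h1
    rw [if_neg (by omega)] at h1
    obtain ⟨g, -, hg⟩ := h1
    refine ⟨g, fun b hb hbc => ?_⟩
    have h2 := congrFun hg b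
    simp only [cobOn, LinearMap.coe_mk, AddHom.coe_mk, Pi.smul_apply, smul_eq_mul] at h2
    rw [if_pos ⟨hb, hbc⟩, if_pos ⟨hb, hbc⟩] at h2
    exact h2
  choose g hg using Hg
  have hcard : ∀ s ∈ (oct L).faces, s.card ≤ k + 1 := by
    intro s hs
    rw [← hs.2]; exact hdim.1 _ hs.1
  refine vanish Φ k hk (fun σ τ => if IsCell (oct L) σ τ ∧ σ.card = k + 1 then
    (-1) ^ k * g σ (pface τ) else 0) ?_ j ?_
  · intro σ τ hn
    exact if_neg (fun h => hn h.1)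
  · intro σ τ hc hN
    have h1 := hcard σ hc.1
    have h2 := hcard τ hc.2.1
    have h1' : σ.card = k + 1 := by omega
    have h2' : τ.card = k + 1 := by omega
    rw [A0_cell hc, A_eq_M hc.2.2 hc.2.1.2, ← hg σ (pface τ) hc.2.1.1 (by rw [hc.2.1.2, h2']),
      ← S_pface hc.2.1.2]
    unfold D
    rw [S_zero, zero_add]
    · have : S olt τ (fun ρ => if IsCell (oct L) σ ρ ∧ σ.card = k + 1 then
          (-1) ^ k * g σ (pface ρ) else 0) = S olt τ (fun ρ => (-1) ^ k * g σ (pface ρ)) := by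
        refine S_congr fun x hx => if_pos ⟨?_, h1'⟩
        have hce := Finset.card_erase_add_one hx
        rcases cell_erase_right hc x with e | e
        · rw [e] at hce; simp at hce; omega
        · exact e
      rw [this, S_mul, h1', Nat.add_sub_cancel, ← mul_assoc, neg_one_sq_pow, one_mul]
    · intro x hx
      have hce := Finset.card_erase_add_one hx
      refine if_neg ?_
      rintro ⟨-, h⟩
      omega

end
end VKAux

namespace VKAux

theorem split_summand {G C : Type} [AddCommGroup G] [AddCommGroup C] (π : G →+ C) (s : C →+ G)
    (h : ∀ c, π (s c) = c) : ∃ (B : Type) (_ : AddCommGroup B), Nonempty (G ≃+ (C × B)) := by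
  refine ⟨π.ker, inferInstance, ⟨?_⟩⟩
  exact
    { toFun := fun g => (π g, ⟨g - s (π g), by simp [AddMonoidHom.mem_ker, h]⟩)
      invFun := fun p => s p.1 + p.2.1
      left_inv := fun g => by simp
      right_inv := fun p => by
        have hp : π p.2.1 = 0 := p.2.2
        ext <;> simp [h, hp]
      map_add' := fun a b => by
        ext
        · simp
        · simp; abel }

theorem group_alt (G : Type) [AddCommGroup G] [AddGroup.FG G] :
    (∃ (B : Type) (_ : AddCommGroup B), Nonempty (G ≃+ (ℤ × B)) ∨
      ∃ r : ℕ, 1 ≤ r ∧ Nonempty (G ≃+ (ZMod (2 ^ r) × B))) ∨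
    ∃ N : ℕ, Odd N ∧ ∀ x : G, N • x = 0 := by
  classical
  obtain ⟨n, ι, _, p, hp, e, ⟨f⟩⟩ := AddCommGroup.equiv_free_prod_directSum_zmod G
  by_cases hn : n = 0
  · by_cases hi : ∃ i, p i = 2 ∧ 1 ≤ e i
    · left
      obtain ⟨i, hpi, hei⟩ := hi
      obtain ⟨B, iB, ⟨E⟩⟩ := split_summand
        (((DFinsupp.evalAddMonoidHom i).comp (AddMonoidHom.snd (Fin n →₀ ℤ)
          (DirectSum ι fun i => ZMod (p i ^ e i)))).comp f.toAddMonoidHom)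
        ((f.symm.toAddMonoidHom.comp (AddMonoidHom.inr _ _)).comp
          (DirectSum.of (fun i => ZMod (p i ^ e i)) i))
        (by intro c; simp [DirectSum.of]; exact DirectSum.of_eq_same (β := fun i => ZMod (p i ^ e i)) i c)
      refine ⟨B, iB, Or.inr ⟨e i, hei, ?_⟩⟩
      rw [hpi] at E
      exact ⟨E⟩
    · right
      push Not at hi
      refine ⟨∏ i, p i ^ e i, ?_, fun x => ?_⟩
      · refine Finset.prod_induction _ Odd (fun a b ha hb => ha.mul hb) odd_one fun i _ => ?_
        by_cases h2 : p i = 2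
        · have := hi i h2
          have : e i = 0 := by omega
          rw [this]; simp
        · exact ((hp i).odd_of_ne_two h2).pow
      · apply f.injective
        rw [map_nsmul, map_zero]
        subst hn
        refine Prod.ext (Subsingleton.elim _ _) ?_
        rw [Prod.smul_snd]
        refine DFinsupp.ext fun i => ?_
        change (∏ i, p i ^ e i) • ((f x).2 i) = 0
        rw [nsmul_eq_mul]
        have : ((∏ i, p i ^ e i : ℕ) : ZMod (p i ^ e i)) = 0 := by
          rw [ZMod.natCast_eq_zero_iff]
          exact Finset.dvd_prod_of_mem _ (Finset.mem_univ i)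
        rw [this, zero_mul]
  · left
    let i : Fin n := ⟨0, Nat.pos_of_ne_zero hn⟩
    obtain ⟨B, iB, E⟩ := split_summand
        (((Finsupp.applyAddHom i).comp (AddMonoidHom.fst (Fin n →₀ ℤ)
          (DirectSum ι fun i => ZMod (p i ^ e i)))).comp f.toAddMonoidHom)
        ((f.symm.toAddMonoidHom.comp (AddMonoidHom.inl _ _)).comp
          (Finsupp.singleAddHom i))
        (by intro c; simp)
    exact ⟨B, iB, Or.inl E⟩

theorem hom_of_summand {G : Type} [AddCommGroup G]
    (h : ∃ (B : Type) (_ : AddCommGroup B), Nonempty (G ≃+ (ℤ × B)) ∨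
      ∃ r : ℕ, 1 ≤ r ∧ Nonempty (G ≃+ (ZMod (2 ^ r) × B))) :
    ∃ φ : G →+ ZMod 2, ∃ g, φ g ≠ 0 := by
  obtain ⟨B, _, ⟨⟨E⟩⟩ | ⟨r, hr, ⟨E⟩⟩⟩ := h
  · refine ⟨((Int.castAddHom (ZMod 2)).comp (AddMonoidHom.fst ℤ B)).comp E.toAddMonoidHom,
      E.symm (1, 0), ?_⟩
    simp
  · have hd : 2 ∣ 2 ^ r := dvd_pow_self 2 (by omega)
    refine ⟨((ZMod.castHom hd (ZMod 2)).toAddMonoidHom.comp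
      (AddMonoidHom.fst (ZMod (2 ^ r)) B)).comp E.toAddMonoidHom, E.symm (1, 0), ?_⟩
    have : (ZMod.castHom hd (ZMod 2)) 1 = 1 := map_one _
    simp only [AddMonoidHom.coe_comp, Function.comp_apply, AddEquiv.toAddMonoidHom_eq_coe,
      AddMonoidHom.coe_coe, AddEquiv.apply_symm_apply, AddMonoidHom.coe_fst,
      RingHom.toAddMonoidHom_eq_coe]
    rw [this]; exact one_ne_zero

section
variable {V : Type} [Fintype V] [DecidableEq V] [LinearOrder V]

theorem topFG (L : SCplx V) (k : ℕ) : AddGroup.FG (topCohomologyZ L k) := by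
  have : Module.Finite ℤ ((cochainsZ L k) ⧸
    (Submodule.comap (cochainsZ L k).subtype (cobndZ L k))) := inferInstance
  exact Module.Finite.iff_addGroup_fg.mp this

/-- The quotient map. -/
noncomputable def qmap (L : SCplx V) (k : ℕ) : cochainsZ L k →+ topCohomologyZ L k :=
  (Submodule.mkQ (Submodule.comap (cochainsZ L k).subtype (cobndZ L k))).toAddMonoidHom

theorem qmap_surj (L : SCplx V) (k : ℕ) : Function.Surjective (qmap L k) :=
  Submodule.mkQ_surjective _

theorem qmap_zero (L : SCplx V) (k : ℕ) (c : cochainsZ L k) :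
    qmap L k c = 0 ↔ c.1 ∈ cobndZ L k := by
  have := Submodule.Quotient.mk_eq_zero
    (Submodule.comap (cochainsZ L k).subtype (cobndZ L k)) (x := c)
  exact this

open Classical in
/-- Truncation of a function to a cochain. -/
noncomputable def trunc (L : SCplx V) (k : ℕ) : (Finset V → ℤ) →ₗ[ℤ] cochainsZ L k where
  toFun f := ⟨fun s => if s ∈ L.faces ∧ s.card = k + 1 then f s else 0, fun s hs => by
    by_contra hn; exact hs (if_neg hn)⟩
  map_add' a b := by
    ext s
    by_cases h : s ∈ L.faces ∧ s.card = k + 1 <;> simp [h]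
  map_smul' r a := by
    ext s
    by_cases h : s ∈ L.faces ∧ s.card = k + 1 <;> simp [h]

theorem trunc_self (L : SCplx V) (k : ℕ) (c : cochainsZ L k) : trunc L k c.1 = c := by
  ext s
  simp only [trunc, LinearMap.coe_mk, AddHom.coe_mk]
  by_cases h : c.1 s = 0
  · simp [h]
  · rw [if_pos (c.2 s h)]

theorem homology_of_hom (L : SCplx V) (k : ℕ) (hdim : IsDimOf L k)
    (φ : topCohomologyZ L k →+ ZMod 2) (hφ : ∃ g, φ g ≠ 0) : ModTwoHomologyNonzero L k := by
  classical
  let ψ : (Finset V → ℤ) →ₗ[ℤ] ZMod 2 :=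
    (φ.comp (qmap L k)).toIntLinearMap.comp (trunc L k)
  let c : Finset V → ZMod 2 := fun s => ψ (Pi.single s 1)
  have hψ : ∀ f, ψ f = ∑ s, f s • c s := by
    intro f
    rw [LinearMap.pi_apply_eq_sum_univ ψ f]
    refine Finset.sum_congr rfl fun s _ => ?_
    congr 2
    funext t
    simp [Pi.single_apply, eq_comm]
  have hc : IsChainOn L k c := by
    intro s hs
    by_contra hn
    apply hs
    have : trunc L k (Pi.single s 1) = 0 := by
      ext t
      simp only [trunc, LinearMap.coe_mk, AddHom.coe_mk]
      by_cases h : t = s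
      · subst h; rw [if_neg hn]; rfl
      · simp [Pi.single_apply, h]
    simp only [c, ψ, LinearMap.comp_apply, this, map_zero]
  have hcob : ∀ f ∈ cobndZ L k, f ∈ cochainsZ L k → ψ f = 0 := by
    intro f hf hf'
    have : trunc L k f = ⟨f, hf'⟩ := trunc_self L k ⟨f, hf'⟩
    simp only [ψ, LinearMap.comp_apply, this, AddMonoidHom.coe_toIntLinearMap,
      AddMonoidHom.comp_apply]
    rw [(qmap_zero L k ⟨f, hf'⟩).2 hf, map_zero]
  refine ⟨c, ⟨hc, fun t ht => ?_⟩, ?_⟩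
  · by_cases hsub : ∃ x ∈ tᶜ, c (insert x t) ≠ 0
    · obtain ⟨x, hx, hcx⟩ := hsub
      have hx' : x ∉ t := Finset.mem_compl.1 hx
      obtain ⟨hf, hcard⟩ := hc _ hcx
      rw [Finset.card_insert_of_notMem hx'] at hcard
      have htk : t.card = k := by omega
      have hk : 1 ≤ k := by have := ht.card_pos; omega
      have htf : t ∈ L.faces := L.down_closed hf (Finset.subset_insert _ _) ht
      have hmem : cobOn L k (Pi.single t 1) ∈ cobndZ L k := by
        unfold cobndZ
        rw [if_neg (by omega)]
        refine ⟨Pi.single t 1, ?_, rfl⟩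
        intro s hs
        by_cases hst : s = t
        · subst hst; exact ⟨htf, by omega⟩
        · simp [Pi.single_apply, hst] at hs
      have hmem' : cobOn L k (Pi.single t 1) ∈ cochainsZ L k := by
        intro s hs
        by_contra hn
        exact hs (if_neg hn)
      have h0 := hcob _ hmem hmem'
      rw [hψ] at h0
      rw [← h0]
      unfold bd2
      have inj : Set.InjOn (fun x => insert x t) ((tᶜ : Finset V) : Set V) := by
        intro a ha b hb hab
        have ha' : a ∉ t := by simpa using ha
        have : a ∈ insert b t := by
          have h := Finset.mem_insert_self a t
          simp only at hab
          rwa [hab] at h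
        rcases Finset.mem_insert.1 this with h | h
        · exact h
        · exact absurd h ha'
      have himg : ∑ x ∈ tᶜ, c (insert x t) = ∑ s ∈ tᶜ.image (fun x => insert x t), c s :=
        (Finset.sum_image inj).symm
      rw [himg]
      symm
      rw [← Finset.sum_subset (Finset.subset_univ (tᶜ.image (fun x => insert x t)))]
      · refine Finset.sum_congr rfl fun s hs => ?_
        obtain ⟨y, hy, rfl⟩ := Finset.mem_image.1 hs
        have hy' : y ∉ t := Finset.mem_compl.1 hy
        by_cases hz : c (insert y t) = 0
        · rw [hz, smul_zero]
        · have hface := hc _ hz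
          have hval : cobOn L k (Pi.single t 1) (insert y t) =
              (-1 : ℤ) ^ (((insert y t).filter (· < y)).card) := by
            simp only [cobOn, LinearMap.coe_mk, AddHom.coe_mk]
            rw [if_pos hface, Finset.sum_eq_single y]
            · rw [Finset.erase_insert hy', Pi.single_eq_same, mul_one]
            · intro b hb hby
              rw [Pi.single_eq_of_ne, mul_zero]
              intro e
              apply hy'
              rw [← e]
              exact Finset.mem_erase.2 ⟨hby.symm, Finset.mem_insert_self _ _⟩
            · intro h; exact absurd (Finset.mem_insert_self _ _) h
          rw [hval]
          rcases neg_one_pow_eq_or ℤ (((insert y t).filter (· < y)).card) with e | e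
          · rw [e, one_smul]
          · rw [e, neg_smul, one_smul, ZMod.neg_eq_self_mod_two]
      · intro s _ hs
        by_cases hface : s ∈ L.faces ∧ s.card = k + 1
        · have : cobOn L k (Pi.single t 1) s = 0 := by
            simp only [cobOn, LinearMap.coe_mk, AddHom.coe_mk]
            rw [if_pos hface]
            refine Finset.sum_eq_zero fun y hy => ?_
            rw [Pi.single_eq_of_ne, mul_zero]
            intro e
            apply hs
            refine Finset.mem_image.2 ⟨y, ?_, ?_⟩
            · rw [← e]; simp
            · rw [← e, Finset.insert_erase hy]
          rw [this, zero_smul]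
        · have : c s = 0 := by
            by_contra h; exact hface (hc s h)
          rw [this, smul_zero]
    · push Not at hsub
      exact Finset.sum_eq_zero hsub
  · rintro ⟨d, hd, hdc⟩
    have hd0 : ∀ s, d s = 0 := by
      intro s
      by_contra h
      obtain ⟨h1, h2⟩ := hd s h
      have := hdim.1 s h1
      omega
    have hc0 : ∀ s, c s = 0 := by
      intro s
      rw [← hdc]; unfold bd2
      exact Finset.sum_eq_zero fun x _ => hd0 _
    obtain ⟨g, hg⟩ := hφ
    obtain ⟨x, rfl⟩ := qmap_surj L k g
    apply hg
    have : ψ x.1 = 0 := by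
      rw [hψ]
      exact Finset.sum_eq_zero fun s _ => by rw [hc0, smul_zero]
    simpa only [ψ, LinearMap.comp_apply, trunc_self, AddMonoidHom.coe_toIntLinearMap,
      AddMonoidHom.comp_apply] using this

end
end VKAux

theorem cohomology_summand_of_vkZ_nonzero
    {V : Type} [Fintype V] [DecidableEq V] [LinearOrder V] (L : SCplx V) (k : ℕ)
    (hdim : IsDimOf L k) (h : vkZNonzero (oct L) olt (2 * k)) :
    (∃ (B : Type) (_ : AddCommGroup B),
      Nonempty (topCohomologyZ L k ≃+ (ℤ × B)) ∨
      ∃ r : ℕ, 1 ≤ r ∧ Nonempty (topCohomologyZ L k ≃+ (ZMod (2 ^ r) × B))) ∧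
    ModTwoHomologyNonzero L k := by
  haveI := VKAux.topFG L k
  have main : ∃ (B : Type) (_ : AddCommGroup B),
      Nonempty (topCohomologyZ L k ≃+ (ℤ × B)) ∨
      ∃ r : ℕ, 1 ≤ r ∧ Nonempty (topCohomologyZ L k ≃+ (ZMod (2 ^ r) × B)) := by
    rcases VKAux.group_alt (topCohomologyZ L k) with h1 | ⟨N, ⟨j, hj⟩, hN⟩
    · exact h1
    · exfalso
      have H : ∀ c ∈ cochainsZ L k, (2 * (j : ℤ) + 1) • c ∈ cobndZ L k := by
        intro c hc
        have h2 := hN (VKAux.qmap L k ⟨c, hc⟩)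
        rw [← map_nsmul, VKAux.qmap_zero] at h2
        have h3 : (2 * (j : ℤ) + 1) • c = N • c := by
          rw [hj, ← natCast_zsmul]; push_cast; rfl
        rw [h3]
        exact h2
      by_cases hk : k = 0
      · subst hk
        obtain ⟨s, hs, hsc⟩ := hdim.2
        have h2 := H (Pi.single s 1) (by
          intro t ht
          by_cases e : t = s
          · subst e; exact ⟨hs, hsc⟩
          · simp [Pi.single_apply, e] at ht)
        unfold cobndZ at h2
        rw [if_pos rfl, Submodule.mem_bot] at h2
        have h3 := congrFun h2 s
        simp at h3
        omega
      · obtain ⟨Φ, hΦ⟩ := h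
        exact hΦ (VKAux.vanish_oct L k (by omega) hdim j H Φ)
  refine ⟨main, ?_⟩
  obtain ⟨φ, hφ⟩ := VKAux.hom_of_summand main
  exact VKAux.homology_of_hom L k hdim φ hφ
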